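/- The quasi R-matrix of U_q(sl_{n+1}) admits the following refined factorization into 4·binom(n+2,3) quantum dilogarithms of cluster monomials, as an identity in A⟦t⟧: the ordered product ∏_{(i,j)} ψ_{j−i+1}(E_{i,j} ⊗ F_{i,j}), taken over all pairs 1 ≤ i ≤ j ≤ n in lexicographic order of (i,j) (leftmost factor (1,1)), equals ∏_{k=1}^{n} ∏_{j=1}^{θ(k)} ∏_{i=−j}^{j−1} ψ_1(w_j^i ⊗ m_{θ(j)}^{k−θ(j)−1}) · ∏_{k=1}^{n} ∏_{j=θ(k)}^{n} ∏_{i=−θ(j)}^{θ(j)−1} ψ_1(w_{θ(j)}^{i} ⊗ m_j^{j−θ(k)}), where each multiple product is expanded from left to right with indices in ascending order (first k, then j, then i). -/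

import Mathlib

noncomputable section

/-- The ground field `𝕂 = ℂ(q)`, the field of rational functions over `ℂ`. -/
abbrev Kq : Type := RatFunc ℂ

/-- The formal variable `q ∈ ℂ(q)`. -/
def qq : Kq := RatFunc.X

/-- `𝐢 = √−1 ∈ ℂ`, viewed as a constant in `𝕂 = ℂ(q)`. -/
def ii : Kq := RatFunc.C Complex.I

/-- `θ(i) = n + 1 − i`. -/
def th (n : ℕ) (i : ℤ) : ℤ := (n : ℤ) + 1 - i

/-- Labels for the vertices of the `𝒟ₙ`-quiver: `V i r` stands for `V_{i,r}`
(the canonical labels), and `C i` stands for the central vertex `Λ_{i,0}`. -/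
inductive DnLabel : Type
  | V : ℤ → ℤ → DnLabel
  | C : ℤ → DnLabel
deriving DecidableEq

/-- Validity of a label for given rank `n`: `V i r` requires `1 ≤ i ≤ n`, `−i ≤ r ≤ i`;
`C i` requires `1 ≤ i ≤ n`.  There are `n² + 3n` valid labels. -/
def DnLabel.valid (n : ℕ) : DnLabel → Prop
  | .V i r => 1 ≤ i ∧ i ≤ (n : ℤ) ∧ -i ≤ r ∧ r ≤ i
  | .C i => 1 ≤ i ∧ i ≤ (n : ℤ)

instance (n : ℕ) (v : DnLabel) : Decidable (v.valid n) := by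
  cases v <;> unfold DnLabel.valid <;> infer_instance

/-- The vertex set of the `𝒟ₙ`-quiver. -/
def DnVertex (n : ℕ) := {v : DnLabel // v.valid n}

/-- The canonical label of the vertex `Λ_{i,r}`, using the identifications
`Λ_{a,b} = V_{θ(b),−θ(a)}` for `b > 0` and `Λ_{a,b} = V_{θ(−b),θ(a)}` for `b < 0`. -/
def Lam (n : ℕ) (i r : ℤ) : DnLabel :=
  if 0 < r then .V (th n r) (-(th n i))
  else if r < 0 then .V (th n (-r)) (th n i)
  else .C i

/-- The list of arrows `(source, target, doubled weight)` of the `𝒟ₙ`-quiver, obtained by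
amalgamating two copies of the Fock–Goncharov `(n+1)`-triangle quiver along two pairs of
sides.  Solid (weight `1`) arrows get doubled weight `2`, dashed (weight `1/2`) arrows get
doubled weight `1`.  The families are: the horizontal `V_i`- and `Λ_i`-path arrows, the
dashed boundary arrows along the two frozen columns, and, for each `1 ≤ i < n`, the
oriented cycle `V_{i,0} → V_{i+1,−1} → ⋯ → V_{n,i−n} → Λ_{i,0} → V_{n,n−i} → ⋯ → V_{i+1,1} → V_{i,0}`
through the central column. -/
def dnArrows (n : ℕ) : List (DnLabel × DnLabel × ℤ) :=
  ((List.range n).flatMap fun i0 =>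
    (List.range (2 * i0 + 2)).map fun k =>
      (DnLabel.V ((i0 : ℤ) + 1) (-((i0 : ℤ) + 1) + k),
       DnLabel.V ((i0 : ℤ) + 1) (-((i0 : ℤ) + 1) + k + 1), 2))
  ++ ((List.range n).flatMap fun i0 =>
    (List.range (2 * i0 + 2)).map fun k =>
      (Lam n ((i0 : ℤ) + 1) (-((i0 : ℤ) + 1) + k),
       Lam n ((i0 : ℤ) + 1) (-((i0 : ℤ) + 1) + k + 1), 2))
  ++ ((List.range (n - 1)).map fun i0 =>
      (DnLabel.V ((i0 : ℤ) + 1) (-((i0 : ℤ) + 1)),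
       DnLabel.V ((i0 : ℤ) + 2) (-((i0 : ℤ) + 2)), 1))
  ++ ((List.range (n - 1)).map fun i0 =>
      (DnLabel.V ((i0 : ℤ) + 2) ((i0 : ℤ) + 2),
       DnLabel.V ((i0 : ℤ) + 1) ((i0 : ℤ) + 1), 1))
  ++ ((List.range (n - 1)).flatMap fun i0 =>
      (((List.range (n - 1 - i0)).map fun k =>
          (DnLabel.V ((i0 : ℤ) + 1 + k) (-(k : ℤ)),
           DnLabel.V ((i0 : ℤ) + 2 + k) (-(k : ℤ) - 1), 2))
        ++ [(DnLabel.V (n : ℤ) ((i0 : ℤ) + 1 - n), DnLabel.C ((i0 : ℤ) + 1), 2),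
            (DnLabel.C ((i0 : ℤ) + 1), DnLabel.V (n : ℤ) ((n : ℤ) - (i0 + 1)), 2)]
        ++ ((List.range (n - 1 - i0)).map fun k =>
          (DnLabel.V ((i0 : ℤ) + 2 + k) ((k : ℤ) + 1),
           DnLabel.V ((i0 : ℤ) + 1 + k) (k : ℤ), 2))))

/-- The doubled exchange matrix `2·ε_{uv}` of the `𝒟ₙ`-quiver. -/
def eps2 (n : ℕ) (u v : DnLabel) : ℤ :=
  ((dnArrows n).map fun a =>
    (if a.1 = u ∧ a.2.1 = v then a.2.2 else 0)
      - (if a.1 = v ∧ a.2.1 = u then a.2.2 else 0)).sum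

/-- The defining relations of the quantum torus algebra `𝒟ₙ`: generators `X_v^{±1}`
(`Sum.inl v` is `X_v`, `Sum.inr v` is `X_v⁻¹`) with `X_u X_v = q^{2 ε_{vu}} X_v X_u`. -/
inductive DnRel (n : ℕ) :
    FreeAlgebra Kq (DnVertex n ⊕ DnVertex n) →
      FreeAlgebra Kq (DnVertex n ⊕ DnVertex n) → Prop
  | comm (u v : DnVertex n) :
      DnRel n (FreeAlgebra.ι Kq (Sum.inl u) * FreeAlgebra.ι Kq (Sum.inl v))
        ((qq ^ eps2 n v.1 u.1) • (FreeAlgebra.ι Kq (Sum.inl v) * FreeAlgebra.ι Kq (Sum.inl u)))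
  | mul_inv (v : DnVertex n) :
      DnRel n (FreeAlgebra.ι Kq (Sum.inl v) * FreeAlgebra.ι Kq (Sum.inr v)) 1
  | inv_mul (v : DnVertex n) :
      DnRel n (FreeAlgebra.ι Kq (Sum.inr v) * FreeAlgebra.ι Kq (Sum.inl v)) 1

/-- The quantum torus algebra `𝒟ₙ`. -/
abbrev Dtorus (n : ℕ) := RingQuot (DnRel n)

/-- The cluster variable `X_v ∈ 𝒟ₙ` attached to a label (junk value `1` on invalid labels). -/
def Xg (n : ℕ) (v : DnLabel) : Dtorus n :=
  if h : v.valid n then RingQuot.mkAlgHom Kq (DnRel n) (FreeAlgebra.ι Kq (Sum.inl ⟨v, h⟩)) else 1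

/-- The inverse cluster variable `X_v⁻¹ ∈ 𝒟ₙ` (junk value `1` on invalid labels). -/
def Xinv (n : ℕ) (v : DnLabel) : Dtorus n :=
  if h : v.valid n then RingQuot.mkAlgHom Kq (DnRel n) (FreeAlgebra.ι Kq (Sum.inr ⟨v, h⟩)) else 1

/-- The ordered product `X_{V_{i,−i}} X_{V_{i,1−i}} ⋯ X_{V_{i,r}}`. -/
def Vprod (n : ℕ) (i r : ℤ) : Dtorus n :=
  ((List.range (r + i + 1).toNat).map fun k => Xg n (.V i (-i + k))).prod

/-- The ordered product `X_{Λ_{i,−i}} X_{Λ_{i,1−i}} ⋯ X_{Λ_{i,r}}`. -/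
def Lprod (n : ℕ) (i r : ℤ) : Dtorus n :=
  ((List.range (r + i + 1).toNat).map fun k => Xg n (Lam n i (-i + k))).prod

/-- `w_i^r = 𝐢 q^{i+r} X_{V_{i,−i}} X_{V_{i,1−i}} ⋯ X_{V_{i,r}}`. -/
def ww (n : ℕ) (i r : ℤ) : Dtorus n := (ii * qq ^ (i + r)) • Vprod n i r

/-- `m_i^r = 𝐢 q^{i+r} X_{Λ_{i,−i}} X_{Λ_{i,1−i}} ⋯ X_{Λ_{i,r}}`. -/
def mm (n : ℕ) (i r : ℤ) : Dtorus n := (ii * qq ^ (i + r)) • Lprod n i r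


/-- `E_i = Σ_{r=−i}^{i−1} w_i^r ∈ 𝒟ₙ`, the image of the Chevalley generator `E_i`. -/
def Ev (n : ℕ) (i : ℤ) : Dtorus n := ∑ r ∈ Finset.Icc (-i) (i - 1), ww n i r

/-- `F_j = Σ_{r=−θ(j)}^{θ(j)−1} m_{θ(j)}^r ∈ 𝒟ₙ`, the image of the Chevalley generator `F_j`. -/
def Fv (n : ℕ) (j : ℤ) : Dtorus n :=
  ∑ r ∈ Finset.Icc (-(th n j)) (th n j - 1), mm n (th n j) r

/-- Auxiliary recursion: `EEaux n i k = E_{i,i+k}`. -/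
def EEaux (n : ℕ) (i : ℤ) : ℕ → Dtorus n
  | 0 => Ev n i
  | k + 1 => (qq - qq⁻¹)⁻¹ •
      (EEaux n i k * Ev n (i + k + 1) - qq • (Ev n (i + k + 1) * EEaux n i k))

/-- The quantum root vector `E_{i,j}`, defined by `E_{i,i} = E_i` and
`E_{i,j} = (E_{i,j−1}E_j − qE_jE_{i,j−1})/(q−q^{−1})`. -/
def EE (n : ℕ) (i j : ℤ) : Dtorus n := EEaux n i (j - i).toNat

/-- Auxiliary recursion: `FFaux n i k = F_{i,i+k}`. -/
def FFaux (n : ℕ) (i : ℤ) : ℕ → Dtorus n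
  | 0 => Fv n i
  | k + 1 => (qq - qq⁻¹)⁻¹ •
      (Fv n (i + k + 1) * FFaux n i k - qq⁻¹ • (FFaux n i k * Fv n (i + k + 1)))

/-- The quantum root vector `F_{i,j}`, defined by `F_{i,i} = F_i` and
`F_{i,j} = (F_jF_{i,j−1} − q^{−1}F_{i,j−1}F_j)/(q−q^{−1})`. -/
def FF (n : ℕ) (i j : ℤ) : Dtorus n := FFaux n i (j - i).toNat

open scoped TensorProduct

/-- `A = 𝒟ₙ ⊗_𝕂 𝒟ₙ`. -/
abbrev AA (n : ℕ) := Dtorus n ⊗[Kq] Dtorus n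

/-- `∏_{j=1}^{m} (q^{2j} − 1)`. -/
def qfac (m : ℕ) : Kq := ∏ j ∈ Finset.range m, (qq ^ (2 * (j + 1)) - 1)

/-- The quantum dilogarithm `ψ_h(x) = Ψ^q(−t^h x) ∈ B⟦t⟧`, i.e. the t-adically convergent
infinite product `∏_{k=0}^{∞} (1 − q^{2k+1} t^h x)^{−1}`; explicitly it is the
`q`-exponential series `Σ_{m≥0} (−1)^m q^m x^m t^{hm} / ∏_{j=1}^{m}(q^{2j} − 1)`,
the unique solution with constant term `1` of `Ψ^q(q²z) = (1+qz)Ψ^q(z)` at `z = −t^h x`. -/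
def psiH {B : Type*} [Ring B] [Algebra Kq B] (h : ℕ) (x : B) : PowerSeries B :=
  PowerSeries.mk fun d =>
    if 0 < h ∧ h ∣ d then
      (((-1 : Kq) ^ (d / h) * qq ^ (d / h) / qfac (d / h)) • x ^ (d / h))
    else 0

/-- The ordered product `∏_{(i,j)} ψ_{j−i+1}(E_{i,j} ⊗ F_{i,j})` over all pairs
`1 ≤ i ≤ j ≤ n` in lexicographic order: this is the quasi `R`-matrix of `U_q(sl_{n+1})`
for the normal ordering `α₁ ≺ α₁+α₂ ≺ ⋯ ≺ α₁+⋯+αₙ ≺ α₂ ≺ ⋯ ≺ αₙ`,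
with the `t`-weights recording the heights of the roots. -/
def quasiRList (n : ℕ) : List (PowerSeries (AA n)) :=
  (List.range n).flatMap fun i0 =>
    (List.range (n - i0)).map fun k =>
      psiH (k + 1) ((EE n ((i0 : ℤ) + 1) ((i0 : ℤ) + 1 + k)) ⊗ₜ[Kq]
        (FF n ((i0 : ℤ) + 1) ((i0 : ℤ) + 1 + k)))

/-- The first factor `∏_{k=1}^{n} ∏_{j=1}^{θ(k)} ∏_{i=−j}^{j−1} ψ_1(w_j^i ⊗ m_{θ(j)}^{k−θ(j)−1})`,
expanded from left to right with all indices ascending. -/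
def rFactList1 (n : ℕ) : List (PowerSeries (AA n)) :=
  (List.range n).flatMap fun k0 =>
    (List.range (n - k0)).flatMap fun j0 =>
      (List.range (2 * j0 + 2)).map fun i0 =>
        psiH 1 ((ww n ((j0 : ℤ) + 1) (-((j0 : ℤ) + 1) + i0)) ⊗ₜ[Kq]
          (mm n (th n ((j0 : ℤ) + 1)) (((k0 : ℤ) + 1) - th n ((j0 : ℤ) + 1) - 1)))

/-- The second factor `∏_{k=1}^{n} ∏_{j=θ(k)}^{n} ∏_{i=−θ(j)}^{θ(j)−1} ψ_1(w_{θ(j)}^i ⊗ m_j^{j−θ(k)})`,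
expanded from left to right with all indices ascending. -/
def rFactList2 (n : ℕ) : List (PowerSeries (AA n)) :=
  (List.range n).flatMap fun k0 =>
    (List.range (k0 + 1)).flatMap fun j1 =>
      (List.range (2 * (k0 + 1 - j1))).map fun i0 =>
        psiH 1 ((ww n (th n ((n : ℤ) - k0 + j1)) (-(th n ((n : ℤ) - k0 + j1)) + i0)) ⊗ₜ[Kq]
          (mm n ((n : ℤ) - k0 + j1) (((n : ℤ) - k0 + j1) - th n ((k0 : ℤ) + 1))))

theorem qq_ne_zero : qq ≠ 0 := RatFunc.X_ne_zero

theorem qq_pow_ne_one {m : ℕ} (hm : m ≠ 0) : qq ^ m ≠ 1 := by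
  intro h
  have h1 : (algebraMap (Polynomial ℂ) (RatFunc ℂ)) (Polynomial.X ^ m) =
      algebraMap (Polynomial ℂ) (RatFunc ℂ) 1 := by
    simpa [qq] using h
  have h2 := congrArg Polynomial.natDegree (RatFunc.algebraMap_injective ℂ h1)
  simp at h2
  exact hm h2

theorem qq_sub_inv_ne_zero : qq - qq⁻¹ ≠ 0 := by
  intro h
  have h1 : qq = qq⁻¹ := sub_eq_zero.mp h
  have h2 : qq ^ 2 = 1 := by
    rw [pow_two]
    nth_rewrite 2 [h1]
    exact mul_inv_cancel₀ qq_ne_zero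
  exact qq_pow_ne_one two_ne_zero h2

theorem qfac_succ (m : ℕ) : qfac (m + 1) = qfac m * (qq ^ (2 * (m + 1)) - 1) :=
  Finset.prod_range_succ _ _

theorem qfac_ne_zero (m : ℕ) : qfac m ≠ 0 :=
  Finset.prod_ne_zero_iff.mpr fun j _ => sub_ne_zero.mpr (qq_pow_ne_one (by omega))

theorem qnum_ne_zero (m : ℕ) : qq⁻¹ * (1 - qq ^ (2 * (m + 1))) ≠ 0 :=
  mul_ne_zero (inv_ne_zero qq_ne_zero) (sub_ne_zero.mpr (qq_pow_ne_one (by omega)).symm)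

/-- `x` and `y` skew-commute with exponent `c`: `x y = q^c y x`. -/
def QComm {B : Type*} [Ring B] [Algebra Kq B] (c : ℤ) (x y : B) : Prop :=
  x * y = qq ^ c • (y * x)

namespace QComm

variable {B : Type*} [Ring B] [Algebra Kq B] {c d : ℤ} {x y z : B}

theorem symm (h : QComm c x y) : QComm (-c) y x := by
  unfold QComm at *
  rw [h, smul_smul, ← zpow_add₀ qq_ne_zero]
  simp

theorem commute (h : QComm 0 x y) : Commute x y := by
  simpa [QComm, Commute, SemiconjBy] using h

theorem of_commute (h : Commute x y) : QComm 0 x y := by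
  simpa [QComm, Commute, SemiconjBy] using h

theorem mul_right (h : QComm c x y) (h' : QComm d x z) : QComm (c + d) x (y * z) := by
  unfold QComm at *
  rw [← mul_assoc, h, smul_mul_assoc, mul_assoc, h', mul_smul_comm, smul_smul,
    ← zpow_add₀ qq_ne_zero, mul_assoc]

theorem mul_left (h : QComm c x z) (h' : QComm d y z) : QComm (c + d) (x * y) z := by
  have := (h.symm.mul_right h'.symm).symm
  rwa [show -(-c + -d) = c + d by ring] at this

theorem smul_right (h : QComm c x y) (a : Kq) : QComm c x (a • y) := by
  unfold QComm at *
  rw [mul_smul_comm, h, smul_mul_assoc, smul_comm]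

theorem smul_left (h : QComm c x y) (a : Kq) : QComm c (a • x) y := by
  have := (h.symm.smul_right a).symm
  rwa [neg_neg] at this

theorem add_right (h : QComm c x y) (h' : QComm c x z) : QComm c x (y + z) := by
  unfold QComm at *
  rw [mul_add, h, h', add_mul, smul_add]

theorem sub_right (h : QComm c x y) (h' : QComm c x z) : QComm c x (y - z) := by
  unfold QComm at *
  rw [mul_sub, h, h', sub_mul, smul_sub]

theorem zero_right (c : ℤ) (x : B) : QComm c x 0 := by simp [QComm]

theorem add_left (h : QComm c x z) (h' : QComm c y z) : QComm c (x + y) z := by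
  have := (h.symm.add_right h'.symm).symm
  rwa [neg_neg] at this

theorem congr_exp (h : QComm c x y) (e : c = d) : QComm d x y := e ▸ h

theorem pow_right (h : QComm c x y) (m : ℕ) : QComm (m * c) x (y ^ m) := by
  induction m with
  | zero => simpa using of_commute (Commute.one_right x)
  | succ m ih =>
    rw [pow_succ]
    exact (ih.mul_right h).congr_exp (by push_cast; ring)

theorem tmul {B' : Type*} [Ring B'] [Algebra Kq B'] {x' y' : B'} (h : QComm c x y)
    (h' : QComm d x' y') : QComm (c + d) (x ⊗ₜ[Kq] x') (y ⊗ₜ[Kq] y') := by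
  unfold QComm at *
  rw [Algebra.TensorProduct.tmul_mul_tmul, Algebra.TensorProduct.tmul_mul_tmul, h, h',
    TensorProduct.smul_tmul_smul, ← zpow_add₀ qq_ne_zero]

end QComm

/-- The `q`-divided power `(-q)^m x^m / ∏_{j=1}^m (q^{2j} - 1)`, the `m`-th Taylor term of the
quantum dilogarithm. -/
def qdiv {B : Type*} [Ring B] [Algebra Kq B] (m : ℕ) (x : B) : B :=
  ((-1 : Kq) ^ m * qq ^ m / qfac m) • x ^ m

section DividedPowers

variable {B : Type*} [Ring B] [Algebra Kq B]

@[simp] theorem qdiv_zero (x : B) : qdiv 0 x = 1 := by simp [qdiv, qfac]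

theorem mul_qdiv (m : ℕ) (x : B) :
    x * qdiv m x = (qq⁻¹ * (1 - qq ^ (2 * (m + 1)))) • qdiv (m + 1) x := by
  unfold qdiv
  rw [mul_smul_comm, ← pow_succ', smul_smul, qfac_succ]
  congr 1
  have h1 := qfac_ne_zero m
  have h2 : qq ^ (2 * (m + 1)) - 1 ≠ 0 := sub_ne_zero.mpr (qq_pow_ne_one (by omega))
  have h3 := qq_ne_zero
  field_simp
  ring

theorem QComm.qdiv_right {c : ℤ} {x y : B} (h : QComm c x y) (m : ℕ) :
    QComm (m * c) x (qdiv m y) :=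
  (h.pow_right m).smul_right _

theorem QComm.mul_qdiv_two {x y : B} (h : QComm 2 x y) (m : ℕ) :
    x * qdiv m y = qq ^ (2 * m) • (qdiv m y * x) := by
  have := h.qdiv_right m
  unfold QComm at this
  rw [this]
  congr 1
  rw [← zpow_natCast]
  congr 1
  push_cast
  ring

theorem sum_antidiagonal_qdiff (n : ℕ) (G : ℕ → ℕ → B) :
    ∑ p ∈ Finset.HasAntidiagonal.antidiagonal n,
      ((qq⁻¹ * (qq ^ (2 * p.1) * (1 - qq ^ (2 * (p.2 + 1))))) •
        G p.1 (p.2 + 1) + (qq⁻¹ * (1 - qq ^ (2 * (p.1 + 1)))) • G (p.1 + 1) p.2) =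
      (qq⁻¹ * (1 - qq ^ (2 * (n + 1)))) •
        ∑ p ∈ Finset.HasAntidiagonal.antidiagonal (n + 1), G p.1 p.2 := by
  have h1 := Finset.Nat.sum_antidiagonal_succ' (n := n)
    (f := fun p => (qq⁻¹ * (qq ^ (2 * p.1) * (1 - qq ^ (2 * p.2)))) • G p.1 p.2)
  have h2 := Finset.Nat.sum_antidiagonal_succ (n := n)
    (f := fun p => (qq⁻¹ * (1 - qq ^ (2 * p.1))) • G p.1 p.2)
  simp only [mul_zero, pow_zero, sub_self, zero_smul, zero_add] at h1 h2
  rw [Finset.sum_add_distrib, ← h1, ← h2, ← Finset.sum_add_distrib, Finset.smul_sum]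
  refine Finset.sum_congr rfl fun p hp => ?_
  rw [← add_smul, ← Finset.HasAntidiagonal.mem_antidiagonal.mp hp]
  congr 1
  ring

theorem qdiv_add {x y : B} (h : QComm 2 y x) (n : ℕ) :
    qdiv n (x + y) = ∑ p ∈ Finset.HasAntidiagonal.antidiagonal n, qdiv p.1 x * qdiv p.2 y := by
  induction n with
  | zero => simp
  | succ n ih =>
    apply smul_right_injective B (qnum_ne_zero n)
    simp only
    rw [← mul_qdiv, ih, ← sum_antidiagonal_qdiff n fun a b => qdiv a x * qdiv b y, Finset.mul_sum]
    refine Finset.sum_congr rfl fun p _ => ?_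
    rw [add_mul, ← mul_assoc, mul_qdiv, ← mul_assoc, h.mul_qdiv_two, smul_mul_assoc,
      smul_mul_assoc, mul_assoc, mul_qdiv, mul_smul_comm, smul_smul, add_comm]
    congr 2
    ring

theorem mul_qdiv_of_bracket {u v c : B} (huv : u * v - v * u = (qq - qq⁻¹) • c)
    (hcu : QComm 2 c u) (m : ℕ) :
    v * qdiv (m + 1) u = qdiv (m + 1) u * v + qdiv m u * c := by
  have hvu : v * u = u * v - (qq - qq⁻¹) • c := by rw [← huv]; abel
  have hq := qq_ne_zero
  have hl : ∀ m, (qq⁻¹ * (1 - qq ^ (2 * (m + 1)))) • (v * qdiv (m + 1) u) =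
      u * (v * qdiv m u) - ((qq - qq⁻¹) * qq ^ (2 * m)) • (qdiv m u * c) := by
    intro m
    rw [← mul_smul_comm, ← mul_qdiv, ← mul_assoc, hvu, sub_mul, smul_mul_assoc,
      hcu.mul_qdiv_two, smul_smul, mul_assoc u v]
  induction m with
  | zero =>
    apply smul_right_injective B (qnum_ne_zero 0)
    simp only
    rw [hl, smul_add, ← smul_mul_assoc _ (qdiv (0 + 1) u), ← mul_qdiv]
    simp only [qdiv_zero, mul_one, one_mul, mul_zero, pow_zero, sub_eq_add_neg]
    rw [← neg_smul]
    congr 2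
    field_simp
    ring
  | succ m ih =>
    apply smul_right_injective B (qnum_ne_zero (m + 1))
    simp only
    rw [hl, ih, smul_add, ← smul_mul_assoc _ (qdiv (m + 1 + 1) u), ← mul_qdiv, mul_add,
      ← mul_assoc, ← mul_assoc,
      mul_qdiv m u, smul_mul_assoc, add_sub_assoc, ← sub_smul]
    congr 2
    field_simp
    ring

/-- The `q`-normal ordering rule underlying the pentagon identity. -/
theorem qdiv_mul_qdiv {u v c : B} (huv : u * v - v * u = (qq - qq⁻¹) • c)
    (hcu : QComm 2 c u) (hvc : QComm 2 v c) (n m : ℕ) :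
    qdiv n v * qdiv m u = ∑ p ∈ Finset.HasAntidiagonal.antidiagonal n,
      (if p.1 ≤ m then qdiv (m - p.1) u else 0) * (qdiv p.1 c * qdiv p.2 v) := by
  have hU : ∀ k, v * (if k ≤ m then qdiv (m - k) u else 0) =
      (if k ≤ m then qdiv (m - k) u else 0) * v +
        (if k + 1 ≤ m then qdiv (m - (k + 1)) u else 0) * c := by
    intro k
    rcases lt_trichotomy k m with h | h | h
    · obtain ⟨l, rfl⟩ := Nat.exists_eq_add_of_lt h
      rw [if_pos (by omega), if_pos (by omega), show k + l + 1 - k = l + 1 by omega,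
        show k + l + 1 - (k + 1) = l by omega]
      exact mul_qdiv_of_bracket huv hcu l
    · subst h
      simp
    · rw [if_neg (by omega), if_neg (by omega)]
      simp
  induction n with
  | zero => simp
  | succ n ih =>
    apply smul_right_injective B (qnum_ne_zero n)
    simp only
    rw [← smul_mul_assoc, ← mul_qdiv, mul_assoc, ih,
      ← sum_antidiagonal_qdiff n fun a b =>
        (if a ≤ m then qdiv (m - a) u else 0) * (qdiv a c * qdiv b v), Finset.mul_sum]
    refine Finset.sum_congr rfl fun p _ => ?_
    rw [← mul_assoc, hU, add_mul, mul_assoc _ v, ← mul_assoc v, hvc.mul_qdiv_two, smul_mul_assoc,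
      mul_assoc _ v, mul_qdiv, mul_smul_comm, mul_smul_comm, mul_smul_comm, smul_smul, mul_assoc _ c,
      ← mul_assoc c,
      mul_qdiv, smul_mul_assoc, mul_smul_comm]
    congr 2
    ring

end DividedPowers

/-- Two power series agree up to and including degree `d`. -/
def AgreeUpTo {B : Type*} [Semiring B] (d : ℕ) (f g : PowerSeries B) : Prop :=
  ∀ k ≤ d, PowerSeries.coeff k f = PowerSeries.coeff k g

theorem AgreeUpTo.mul {B : Type*} [Semiring B] {d : ℕ} {f f' g g' : PowerSeries B}
    (hf : AgreeUpTo d f f') (hg : AgreeUpTo d g g') : AgreeUpTo d (f * g) (f' * g') := by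
  intro k hk
  rw [PowerSeries.coeff_mul, PowerSeries.coeff_mul]
  refine Finset.sum_congr rfl fun p hp => ?_
  have := Finset.HasAntidiagonal.mem_antidiagonal.mp hp
  rw [hf _ (by omega), hg _ (by omega)]

section Dilogarithm

variable {B : Type*} [Ring B] [Algebra Kq B]

/-- The Taylor polynomial of degree `< N` in `t^h x` of the quantum dilogarithm `psiH h x`. -/
def psiTrunc (N h : ℕ) (x : B) : PowerSeries B :=
  ∑ m ∈ Finset.range N, PowerSeries.monomial (h * m) (qdiv m x)

theorem coeff_psiTrunc (N h d : ℕ) (x : B) :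
    PowerSeries.coeff d (psiTrunc N h x) =
      ∑ m ∈ Finset.range N, if h * m = d then qdiv m x else 0 := by
  simp only [psiTrunc, map_sum, PowerSeries.coeff_monomial]
  exact Finset.sum_congr rfl fun m _ => by simp only [eq_comm]

theorem psiH_agree {h : ℕ} (hh : 0 < h) (d : ℕ) (x : B) :
    AgreeUpTo d (psiH h x) (psiTrunc (d + 1) h x) := by
  intro k hk
  rw [coeff_psiTrunc, psiH, PowerSeries.coeff_mk]
  by_cases hd : h ∣ k
  · obtain ⟨m, rfl⟩ := hd
    rw [if_pos ⟨hh, dvd_mul_right _ _⟩, Nat.mul_div_cancel_left _ hh, Finset.sum_eq_single m]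
    · simp [qdiv]
    · intro b _ hb
      rw [if_neg]
      exact fun e => hb (Nat.eq_of_mul_eq_mul_left hh e)
    · intro hm
      exact absurd (Finset.mem_range.mpr (by nlinarith)) hm
  · rw [if_neg fun e => hd e.2, Finset.sum_eq_zero]
    intro m _
    rw [if_neg]
    rintro rfl
    exact hd (dvd_mul_right _ _)

theorem psiH_commute {x y : B} (hxy : Commute x y) (h h' : ℕ) :
    Commute (psiH h x) (psiH h' y) := by
  ext d
  rw [PowerSeries.coeff_mul, PowerSeries.coeff_mul, ← Finset.Nat.sum_antidiagonal_swap]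
  refine Finset.sum_congr rfl fun p _ => ?_
  simp only [psiH, PowerSeries.coeff_mk, Prod.fst_swap, Prod.snd_swap]
  split_ifs
  · exact (((hxy.pow_pow _ _).smul_left _).smul_right _)
  all_goals simp

theorem psiH_zero (h : ℕ) (hh : 0 < h) : psiH h (0 : B) = 1 := by
  ext d
  rw [psiH, PowerSeries.coeff_mk, PowerSeries.coeff_one]
  by_cases hd : d = 0
  · subst hd
    simp [hh, qfac]
  · rw [if_neg hd]
    split_ifs with hc
    · have : d / h ≠ 0 := (Nat.div_pos (Nat.le_of_dvd (by omega) hc.2) hh).ne'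
      simp [this]
    · rfl

theorem coeff_psiTrunc_mul (N h h' d : ℕ) (x y : B) :
    PowerSeries.coeff d (psiTrunc N h x * psiTrunc N h' y) =
      ∑ a ∈ Finset.range N, ∑ b ∈ Finset.range N with h * a + h' * b = d,
        qdiv a x * qdiv b y := by
  rw [psiTrunc, psiTrunc, Finset.sum_mul_sum]
  simp only [map_sum, PowerSeries.monomial_mul_monomial, PowerSeries.coeff_monomial,
    Finset.sum_filter, @eq_comm _ d]

theorem coeff_psiTrunc_mul_mul (N h h' h'' d : ℕ) (x y z : B) :
    PowerSeries.coeff d (psiTrunc N h x * psiTrunc N h' y * psiTrunc N h'' z) =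
      ∑ a ∈ Finset.range N, ∑ b ∈ Finset.range N,
        ∑ c ∈ Finset.range N with h * a + h' * b + h'' * c = d,
          qdiv a x * (qdiv b y * qdiv c z) := by
  rw [psiTrunc, psiTrunc, psiTrunc, Finset.sum_mul_sum, Finset.sum_mul]
  simp only [map_sum, PowerSeries.monomial_mul_monomial, PowerSeries.coeff_monomial,
    Finset.sum_filter, @eq_comm _ d, Finset.sum_mul, Finset.mul_sum, mul_assoc]
  exact Finset.sum_congr rfl fun _ _ => Finset.sum_comm

/-- The `q`-exponential property of the quantum dilogarithm. -/
theorem psiH_add {x y : B} {h : ℕ} (hh : 0 < h) (hyx : QComm 2 y x) :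
    psiH h (x + y) = psiH h x * psiH h y := by
  ext d
  rw [((psiH_agree hh d x).mul (psiH_agree hh d y)) d le_rfl, psiH_agree hh d (x + y) d le_rfl,
    coeff_psiTrunc, coeff_psiTrunc_mul, ← Finset.sum_filter]
  simp only [qdiv_add hyx]
  rw [Finset.sum_sigma', Finset.sum_sigma']
  refine Finset.sum_nbij' (fun s => ⟨s.2.1, s.2.2⟩) (fun p => ⟨p.1 + p.2, (p.1, p.2)⟩)
    ?_ ?_ ?_ ?_ ?_
  · rintro ⟨m, a, b⟩ hm
    simp only [Finset.mem_sigma, Finset.mem_filter, Finset.mem_range,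
      Finset.HasAntidiagonal.mem_antidiagonal] at hm ⊢
    refine ⟨by omega, by omega, ?_⟩
    rw [← hm.1.2, ← hm.2, mul_add]
  · rintro ⟨a, b⟩ hm
    simp only [Finset.mem_sigma, Finset.mem_filter, Finset.mem_range,
      Finset.HasAntidiagonal.mem_antidiagonal] at hm ⊢
    exact ⟨⟨by nlinarith, by rw [← hm.2.2, mul_add]⟩, trivial⟩
  · rintro ⟨m, a, b⟩ hm
    simp only [Finset.mem_sigma, Finset.HasAntidiagonal.mem_antidiagonal] at hm
    simp [hm.2]
  · rintro ⟨a, b⟩ _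
    rfl
  · rintro ⟨m, a, b⟩ _
    rfl

/-- The pentagon identity for the quantum dilogarithm. -/
theorem psiH_pentagon {u v c : B} {h : ℕ} (hh : 0 < h)
    (huv : u * v - v * u = (qq - qq⁻¹) • c) (hcu : QComm 2 c u) (hvc : QComm 2 v c) :
    psiH 1 v * psiH h u = psiH h u * psiH (h + 1) c * psiH 1 v := by
  ext d
  rw [((psiH_agree one_pos d v).mul (psiH_agree hh d u)) d le_rfl,
    (((psiH_agree hh d u).mul (psiH_agree h.succ_pos d c)).mul (psiH_agree one_pos d v)) d le_rfl,
    coeff_psiTrunc_mul, coeff_psiTrunc_mul_mul]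
  simp only [qdiv_mul_qdiv huv hcu hvc, ite_mul, zero_mul, ← Finset.sum_filter]
  simp only [Finset.sum_sigma']
  refine Finset.sum_nbij' (fun s => ⟨s.2.1 - s.2.2.1, s.2.2.1, s.2.2.2⟩)
    (fun p => ⟨p.2.1 + p.2.2, p.1 + p.2.1, (p.2.1, p.2.2)⟩) ?_ ?_ ?_ ?_ ?_
  · rintro ⟨n, m, k, e⟩ hm
    simp only [Finset.mem_sigma, Finset.mem_filter, Finset.mem_range,
      Finset.HasAntidiagonal.mem_antidiagonal] at hm ⊢
    obtain ⟨hn, ⟨hm, hd⟩, hk, hkm⟩ := hm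
    obtain ⟨l, rfl⟩ := Nat.exists_eq_add_of_le hkm
    refine ⟨by omega, by omega, by omega, ?_⟩
    rw [← hd, ← hk, Nat.add_sub_cancel_left, Nat.succ_eq_add_one]
    ring
  · rintro ⟨a, b, e⟩ hm
    simp only [Finset.mem_sigma, Finset.mem_filter, Finset.mem_range,
      Finset.HasAntidiagonal.mem_antidiagonal] at hm ⊢
    obtain ⟨ha, hb, he, hd⟩ := hm
    rw [Nat.succ_eq_add_one] at hd
    exact ⟨by nlinarith, ⟨by nlinarith, by rw [← hd]; ring⟩, trivial, by omega⟩
  · rintro ⟨n, m, k, e⟩ hm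
    simp only [Finset.mem_sigma, Finset.mem_filter, Finset.HasAntidiagonal.mem_antidiagonal] at hm
    simp [hm.2.2.1, Nat.sub_add_cancel hm.2.2.2]
  · rintro ⟨a, b, e⟩ _
    simp
  · rintro ⟨n, m, k, e⟩ _
    rfl

end Dilogarithm

theorem serre_right_aux {K B : Type*} [Field K] [Ring B] [Algebra K B] {q : K} (hq : q ≠ 0)
    {x y : B} (h : y * y * x - (q + q⁻¹) • (y * x * y) + x * y * y = 0) :
    (x * y - q • (y * x)) * y = q⁻¹ • (y * (x * y - q • (y * x))) := by
  simp only [sub_mul, mul_sub, smul_mul_assoc, mul_smul_comm, ← mul_assoc]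
  linear_combination (norm := (match_scalars <;> field_simp <;> ring)) h

theorem serre_left_aux {K B : Type*} [Field K] [Ring B] [Algebra K B] {q : K} (hq : q ≠ 0)
    {x y : B} (h : x * x * y - (q + q⁻¹) • (x * y * x) + y * x * x = 0) :
    x * (x * y - q • (y * x)) = q⁻¹ • ((x * y - q • (y * x)) * x) := by
  simp only [sub_mul, mul_sub, smul_mul_assoc, mul_smul_comm, ← mul_assoc]
  linear_combination (norm := (match_scalars <;> field_simp <;> ring)) h

theorem serre_of_left_aux {K B : Type*} [Field K] [Ring B] [Algebra K B] {q : K} (hq : q ≠ 0)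
    {x y : B} (h : x * (x * y - q • (y * x)) = q⁻¹ • ((x * y - q • (y * x)) * x)) :
    x * x * y - (q + q⁻¹) • (x * y * x) + y * x * x = 0 := by
  simp only [sub_mul, mul_sub, smul_mul_assoc, mul_smul_comm, ← mul_assoc] at h
  linear_combination (norm := (match_scalars <;> field_simp <;> ring)) h

theorem serre_middle_aux {K B : Type*} [Field K] [Ring B] [Algebra K B] {q : K} (hq : q ≠ 0)
    (hq2 : q + q⁻¹ ≠ 0) {x y z : B}
    (hx : y * y * x - (q + q⁻¹) • (y * x * y) + x * y * y = 0)
    (hz : y * y * z - (q + q⁻¹) • (y * z * y) + z * y * y = 0) (hxz : x * z = z * x) :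
    y * ((x * y - q • (y * x)) * z - q • (z * (x * y - q • (y * x)))) =
      ((x * y - q • (y * x)) * z - q • (z * (x * y - q • (y * x)))) * y := by
  have hxz' : ∀ w, w * x * z = w * z * x := fun w => by rw [mul_assoc, hxz, mul_assoc]
  have e1 := congrArg (· * z) hx
  have e2 := congrArg (z * ·) hx
  have e3 := congrArg (· * x) hz
  have e4 := congrArg (x * ·) hz
  apply smul_right_injective B hq2
  simp only [sub_mul, mul_sub, add_mul, mul_add, smul_mul_assoc, mul_smul_comm,
    ← mul_assoc, zero_mul, mul_zero, hxz', hxz] at e1 e2 e3 e4 ⊢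
  linear_combination (norm := (match_scalars <;> field_simp <;> ring))
    e4 - e1 + q ^ 2 • e2 - q ^ 2 • e3

/-- The quantum Serre relation of degree `(2,1)` between `x` and `y`. -/
def QSerre {B : Type*} [Ring B] [Algebra Kq B] (x y : B) : Prop :=
  x * x * y - (qq + qq⁻¹) • (x * y * x) + y * x * x = 0

/-- The Cartan integer `(α_i, α_j)` of type `A`. -/
def cartanA (i j : ℤ) : ℤ := if i = j then 2 else if i = j + 1 ∨ j = i + 1 then -1 else 0

/-- A family satisfying the quantum Serre relations of type `A`. -/
structure SerreFamily {B : Type*} [Ring B] [Algebra Kq B] (E : ℤ → B) : Prop where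
  commute : ∀ i j, i + 1 < j → Commute (E i) (E j)
  serre_succ : ∀ i, QSerre (E i) (E (i + 1))
  serre_pred : ∀ i, QSerre (E (i + 1)) (E i)

/-- The normalized `q`-bracket `(xy - q yx) / (q - q⁻¹)`. -/
def qbr {B : Type*} [Ring B] [Algebra Kq B] (x y : B) : B :=
  (qq - qq⁻¹)⁻¹ • (x * y - qq • (y * x))

/-- The root vector attached to `α_i + ⋯ + α_{i+k}`. -/
def rootVec {B : Type*} [Ring B] [Algebra Kq B] (E : ℤ → B) (i : ℤ) : ℕ → B
  | 0 => E i
  | k + 1 => qbr (rootVec E i k) (E (i + k + 1))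

section Serre

variable {B : Type*} [Ring B] [Algebra Kq B]

theorem QComm.qbr_right {c d : ℤ} {x y z : B} (hy : QComm c x y) (hz : QComm d x z) :
    QComm (c + d) x (qbr y z) :=
  ((hy.mul_right hz).sub_right
    (((hz.mul_right hy).congr_exp (add_comm d c)).smul_right qq)).smul_right _

theorem Commute.qbr_right {x y z : B} (hy : Commute x y) (hz : Commute x z) :
    Commute x (qbr y z) :=
  (((QComm.of_commute hy).qbr_right (QComm.of_commute hz))).commute

theorem qq_add_inv_ne_zero : qq + qq⁻¹ ≠ 0 := by
  intro h
  have h1 : qq * (qq + qq⁻¹) = 0 := by rw [h, mul_zero]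
  rw [mul_add, mul_inv_cancel₀ qq_ne_zero] at h1
  apply qq_pow_ne_one (m := 4) (by norm_num)
  linear_combination (qq ^ 2 - 1) * h1

theorem qbr_qcomm_right {x y : B} (h : QSerre y x) : QComm (-1) (qbr x y) y := by
  unfold QComm qbr
  rw [smul_mul_assoc, mul_smul_comm, smul_comm (qq ^ (-1 : ℤ)), zpow_neg_one,
    serre_right_aux qq_ne_zero h]

theorem qcomm_qbr_left {x y : B} (h : QSerre x y) : QComm (-1) x (qbr x y) := by
  unfold QComm qbr
  rw [smul_mul_assoc, mul_smul_comm, smul_comm (qq ^ (-1 : ℤ)), zpow_neg_one,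
    serre_left_aux qq_ne_zero h]

theorem qserre_of_qcomm_qbr {x y : B} (h : QComm (-1) x (qbr x y)) : QSerre x y := by
  unfold QComm qbr at h
  rw [smul_mul_assoc, mul_smul_comm, smul_comm (qq ^ (-1 : ℤ)), zpow_neg_one] at h
  exact serre_of_left_aux qq_ne_zero
    (smul_right_injective B (inv_ne_zero qq_sub_inv_ne_zero) h)

theorem commute_qbr_qbr {x y z : B} (hx : QSerre y x) (hz : QSerre y z) (hxz : Commute x z) :
    Commute y (qbr (qbr x y) z) := by
  unfold qbr
  rw [smul_mul_assoc, mul_smul_comm, smul_comm qq, ← smul_sub]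
  exact Commute.smul_right (Commute.smul_right
    (serre_middle_aux qq_ne_zero qq_add_inv_ne_zero hx hz hxz) _) _

namespace QSerre

variable {x y z : B}

theorem mul_left (h : QSerre y z) (hxy : Commute x y) : QSerre y (x * z) := by
  have e : x * (y * y * z - (qq + qq⁻¹) • (y * z * y) + z * y * y) = 0 := by
    rw [show y * y * z - (qq + qq⁻¹) • (y * z * y) + z * y * y = 0 from h, mul_zero]
  rw [QSerre, ← e, mul_add, mul_sub, mul_smul_comm]
  simp only [← mul_assoc, hxy.eq]
  rw [mul_assoc y x y, hxy.eq, ← mul_assoc]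

theorem mul_right (h : QSerre y z) (hxy : Commute x y) : QSerre y (z * x) := by
  have e : (y * y * z - (qq + qq⁻¹) • (y * z * y) + z * y * y) * x = 0 := by
    rw [show y * y * z - (qq + qq⁻¹) • (y * z * y) + z * y * y = 0 from h, zero_mul]
  rw [QSerre, ← e, add_mul, sub_mul, smul_mul_assoc]
  simp only [mul_assoc, hxy.eq]

theorem smul (h : QSerre y z) (a : Kq) : QSerre y (a • z) := by
  unfold QSerre at *
  rw [mul_smul_comm, mul_smul_comm, smul_mul_assoc, smul_mul_assoc, smul_mul_assoc,
    smul_comm (qq + qq⁻¹), ← smul_sub, ← smul_add, h, smul_zero]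

theorem add (h : QSerre y z) (h' : QSerre y x) : QSerre y (z + x) := by
  unfold QSerre at *
  have : ∀ a b c a' b' c' : B, a - b + c = 0 → a' - b' + c' = 0 →
      a + a' - (b + b') + (c + c') = 0 := by
    intro a b c a' b' c' h1 h2
    rw [show a + a' - (b + b') + (c + c') = (a - b + c) + (a' - b' + c') by abel, h1, h2,
      add_zero]
  simp only [mul_add, add_mul, smul_add]
  exact this _ _ _ _ _ _ h h'

theorem sub (h : QSerre y z) (h' : QSerre y x) : QSerre y (z - x) := by
  rw [sub_eq_add_neg, ← neg_one_smul Kq x]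
  exact h.add (h'.smul _)

theorem qbr_right (h : QSerre y z) (hxy : Commute x y) : QSerre y (qbr x z) :=
  ((h.mul_left hxy).sub ((h.mul_right hxy).smul _)).smul _

theorem qbr_left (h : QSerre y z) (hxy : Commute x y) : QSerre y (qbr z x) :=
  ((h.mul_right hxy).sub ((h.mul_left hxy).smul _)).smul _

end QSerre

theorem qbr_assoc {x y z : B} (hxz : Commute x z) : qbr (qbr x y) z = qbr x (qbr y z) := by
  unfold qbr
  simp only [smul_mul_assoc, mul_smul_comm, smul_comm qq, ← smul_sub]
  congr 2
  simp only [sub_mul, mul_sub, smul_mul_assoc, mul_smul_comm, ← mul_assoc, smul_sub]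
  rw [mul_assoc y x z, hxz.eq, ← mul_assoc]
  abel

/-- The Serre relation quadratic in the root vector `[x, z]`. -/
theorem QSerre.bracket {x y z : B} (hxy : Commute x y) (hxz : QSerre x z) (hzx : QSerre z x)
    (hzy : QSerre z y) : QSerre (qbr x z) y := by
  apply qserre_of_qcomm_qbr
  have h1 : Commute z (qbr (qbr x z) y) := commute_qbr_qbr hzx hzy hxy
  have h2 : QComm (-1) x (qbr (qbr x z) y) := by
    rw [qbr_assoc hxy]
    exact qcomm_qbr_left (hxz.qbr_left hxy.symm)
  exact ((h2.symm.qbr_right (QComm.of_commute h1).symm).symm).congr_exp (by norm_num)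

end Serre

namespace SerreFamily

variable {B : Type*} [Ring B] [Algebra Kq B] {E : ℤ → B}

theorem commute_rootVec_right (hE : SerreFamily E) {l i : ℤ} (k : ℕ) (h : i + k + 1 < l) :
    Commute (E l) (rootVec E i k) := by
  induction k with
  | zero => exact (hE.commute _ _ (by simpa using h)).symm
  | succ k ih =>
    push_cast at h
    exact (ih (by omega)).qbr_right (hE.commute _ _ (by omega)).symm

theorem serre_rootVec_right (hE : SerreFamily E) (i : ℤ) (k : ℕ) :
    QSerre (E (i + k + 1)) (rootVec E i k) := by
  cases k with
  | zero => simpa [rootVec] using hE.serre_pred i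
  | succ k =>
    refine QSerre.qbr_right ?_ ?_
    · have := hE.serre_pred (i + k + 1)
      push_cast
      rwa [show i + (k + 1 : ℤ) + 1 = i + k + 1 + 1 by ring]
    · exact (hE.commute_rootVec_right k (by push_cast; omega)).symm

theorem serre_rootVec_left (hE : SerreFamily E) (i : ℤ) (k : ℕ) :
    QSerre (rootVec E i k) (E (i + k + 1)) := by
  induction k with
  | zero => simpa [rootVec] using hE.serre_succ i
  | succ k ih =>
    refine QSerre.bracket (hE.commute_rootVec_right k (by push_cast; omega)).symm ih
      (hE.serre_rootVec_right i k) ?_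
    have := hE.serre_succ (i + k + 1)
    push_cast
    rwa [show i + (k + 1 : ℤ) + 1 = i + k + 1 + 1 by ring]

theorem rootVec_qcomm_succ (hE : SerreFamily E) (i : ℤ) (k : ℕ) :
    QComm (-1) (rootVec E i k) (rootVec E i (k + 1)) :=
  qcomm_qbr_left (hE.serre_rootVec_left i k)

theorem rootVec_succ_qcomm (hE : SerreFamily E) (i : ℤ) (k : ℕ) :
    QComm (-1) (rootVec E i (k + 1)) (E (i + k + 1)) :=
  qbr_qcomm_right (hE.serre_rootVec_right i k)

theorem commute_rootVec_inner (hE : SerreFamily E) (i : ℤ) (k m : ℕ) :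
    Commute (E (i + k + 1)) (rootVec E i (k + m + 2)) := by
  induction m with
  | zero =>
    refine commute_qbr_qbr (hE.serre_rootVec_right i k) ?_
      (hE.commute_rootVec_right k (by push_cast; omega)).symm
    have := hE.serre_succ (i + k + 1)
    push_cast
    rwa [show i + ((k : ℤ) + 1) + 1 = i + k + 1 + 1 by ring]
  | succ m ih => exact ih.qbr_right (hE.commute _ _ (by push_cast; omega))

end SerreFamily

section Prepend

variable {B : Type*} [Ring B] [Algebra Kq B]

theorem QComm.eq_one {x y : B} (h : QComm 1 x y) : x * y = qq • (y * x) := by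
  simpa [QComm] using h

theorem qserre_of_qcomm_one {x y : B} (h : QComm 1 x y) : QSerre y x := by
  have e : x * y = qq • (y * x) := h.eq_one
  unfold QSerre
  rw [mul_assoc y x y, e, mul_smul_comm, smul_mul_assoc, mul_assoc y x y, e, mul_smul_comm,
    ← mul_assoc, smul_smul, smul_smul, ← one_smul Kq (y * y * x), smul_smul, smul_smul, ← sub_smul,
    ← add_smul]
  convert zero_smul Kq (y * y * x) using 2
  field_simp [qq_ne_zero]
  ring

theorem qserre_add_aux {K C : Type*} [Field K] [Ring C] [Algebra K C] {q : K} (hq : q ≠ 0)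
    {x y z : C} (hyx : y * x = q ^ 2 • (x * y)) (hzx : z * x = q⁻¹ • (x * z))
    (h : y * y * z - (q + q⁻¹) • (y * z * y) + z * y * y = 0) :
    (y + x) * (y + x) * z - (q + q⁻¹) • ((y + x) * z * (y + x)) + z * (y + x) * (y + x) = 0 := by
  have a1 : y * x * z = q ^ 2 • (x * y * z) := by rw [hyx, smul_mul_assoc]
  have a2 : y * z * x = q • (x * y * z) := by
    rw [mul_assoc, hzx, mul_smul_comm, ← mul_assoc, a1, smul_smul]
    congr 1
    field_simp
  have a3 : z * x * y = q⁻¹ • (x * z * y) := by rw [hzx, smul_mul_assoc]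
  have a4 : z * y * x = q • (x * z * y) := by
    rw [mul_assoc, hyx, mul_smul_comm, ← mul_assoc, a3, smul_smul]
    congr 1
    field_simp
  have a5 : x * z * x = q⁻¹ • (x * x * z) := by rw [mul_assoc, hzx, mul_smul_comm, ← mul_assoc]
  have a6 : z * x * x = q⁻¹ • q⁻¹ • (x * x * z) := by rw [hzx, smul_mul_assoc, a5]
  simp only [mul_add, add_mul, a1, a2, a3, a4, a5, a6]
  linear_combination (norm := (match_scalars <;> field_simp <;> ring)) h

theorem QSerre.add_left {x y z : B} (h : QSerre y z) (hxy : QComm (-2) x y) (hxz : QComm 1 x z) :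
    QSerre (y + x) z := by
  refine qserre_add_aux qq_ne_zero ?_ ?_ h
  · have := hxy.symm
    simpa [QComm] using this
  · have := hxz.symm
    simpa [QComm] using this

/-- Adding to `F_j` an element `x` with `x F_i = q^{-(α_j, α_i)} F_i x` preserves the Serre
relations. -/
theorem SerreFamily.update_add {F : ℤ → B} (hF : SerreFamily F) {j : ℤ} {x : B}
    (hx : ∀ i, QComm (-cartanA j i) x (F i)) :
    SerreFamily (Function.update F j (F j + x)) where
  commute i k hik := by
    have hcomm : ∀ l, j + 1 < l ∨ l + 1 < j → Commute x (F l) := fun l hl =>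
      ((hx l).congr_exp (by unfold cartanA; split_ifs <;> omega)).commute
    simp only [Function.update_apply]
    split_ifs with h1 h2 h2
    · omega
    · subst h1
      exact (hF.commute _ _ hik).add_left (hcomm _ (Or.inl hik))
    · subst h2
      exact (hF.commute _ _ hik).add_right (hcomm _ (Or.inr hik)).symm
    · exact hF.commute _ _ hik
  serre_succ i := by
    simp only [Function.update_apply]
    split_ifs with h1 h2 h2
    · omega
    · subst h1
      exact (hF.serre_succ _).add_left ((hx _).congr_exp (by simp [cartanA]))
        ((hx _).congr_exp (by simp [cartanA]))
    · subst h2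
      exact (hF.serre_succ _).add (qserre_of_qcomm_one ((hx _).congr_exp (by simp [cartanA])))
    · exact hF.serre_succ i
  serre_pred i := by
    simp only [Function.update_apply]
    split_ifs with h1 h2 h2
    · omega
    · subst h1
      exact (hF.serre_pred _).add_left ((hx _).congr_exp (by simp [cartanA]))
        ((hx _).congr_exp (by simp [cartanA]))
    · subst h2
      exact (hF.serre_pred _).add (qserre_of_qcomm_one ((hx _).congr_exp (by simp [cartanA])))
    · exact hF.serre_pred i

theorem rootVec_congr {F G : ℤ → B} {i : ℤ} (k : ℕ) (h : ∀ l, i ≤ l → l ≤ i + k → F l = G l) :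
    rootVec F i k = rootVec G i k := by
  induction k with
  | zero => exact h i le_rfl (by simp)
  | succ k ih =>
    push_cast at h
    rw [rootVec, rootVec, ih fun l h1 h2 => h l h1 (by omega), h _ (by omega) (by omega)]

theorem rootVec_zero (k : ℕ) (i : ℤ) : rootVec (fun _ => (0 : B)) i k = 0 := by
  induction k with
  | zero => rfl
  | succ k ih => simp [rootVec, qbr]

theorem QComm.qbr_eq_zero {x y : B} (h : QComm 1 x y) : qbr x y = 0 := by
  rw [qbr, h.eq_one, sub_self, smul_zero]

theorem qbr_add_left (x y z : B) : qbr (x + y) z = qbr x z + qbr y z := by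
  unfold qbr
  rw [add_mul, mul_add, smul_add, add_sub_add_comm, smul_add]

theorem qbr_add_right (x y z : B) : qbr z (x + y) = qbr z x + qbr z y := by
  unfold qbr
  rw [add_mul, mul_add, smul_add, add_sub_add_comm, smul_add]

theorem qbr_smul_left (a : Kq) (x y : B) : qbr (a • x) y = a • qbr x y := by
  unfold qbr
  rw [smul_mul_assoc, mul_smul_comm, smul_comm qq, ← smul_sub, smul_comm]

theorem qbr_mul_left {x y z : B} (h : Commute x z) : qbr (x * y) z = x * qbr y z := by
  unfold qbr
  rw [mul_smul_comm, mul_sub, mul_smul_comm, ← mul_assoc z, ← h.eq, mul_assoc, mul_assoc]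

theorem QComm.qbr_eq {x y : B} (h : QComm 1 y x) : qbr x y = -qq • (x * y) := by
  unfold qbr
  rw [h.eq_one, smul_smul, ← one_smul Kq (x * y), smul_smul, smul_smul, ← sub_smul, smul_smul]
  congr 1
  have := qq_sub_inv_ne_zero
  have h0 := qq_ne_zero
  rw [inv_mul_eq_iff_eq_mul₀ this]
  field_simp
  ring

section Update

variable {F : ℤ → B} {j : ℤ} {x : B}

theorem qcomm_rootVec (hx : ∀ i, QComm (-cartanA j i) x (F i))
    {i : ℤ} (hij : i < j) (k : ℕ) :
    QComm (if i + k + 1 < j then 0 else if i + k + 1 = j then 1 else if i + k = j then -1 else 0)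
      x (rootVec F i k) := by
  induction k with
  | zero => exact (hx i).congr_exp (by unfold cartanA; push_cast; split_ifs <;> omega)
  | succ k ih =>
    exact (ih.qbr_right (hx _)).congr_exp (by unfold cartanA; push_cast; split_ifs <;> omega)

theorem rootVec_update_self (hx : ∀ i, QComm (-cartanA j i) x (F i))
    (k : ℕ) :
    rootVec (Function.update F j (F j + x)) j (k + 1) = rootVec F j (k + 1) := by
  induction k with
  | zero =>
    have h : QComm 1 x (F (j + 1)) := (hx _).congr_exp (by simp [cartanA])
    simp [rootVec, qbr_add_left, h.qbr_eq_zero]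
  | succ k ih =>
    rw [rootVec, ih, Function.update_of_ne (by push_cast; omega), ← rootVec]

theorem rootVec_update_of_eq (hx : ∀ i, QComm (-cartanA j i) x (F i))
    {i : ℤ} {k : ℕ} (h : i + k + 1 = j) :
    rootVec (Function.update F j (F j + x)) i (k + 1) =
      rootVec F i (k + 1) + -qq • (rootVec F i k * x) := by
  have hq : QComm 1 x (rootVec F i k) :=
    (qcomm_rootVec hx (by omega) k).congr_exp (by rw [if_neg (by omega), if_pos h])
  rw [rootVec, rootVec_congr (G := F) k fun l _ _ => Function.update_of_ne (by omega) _ _, h,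
    Function.update_self, qbr_add_right, hq.qbr_eq, rootVec, h]

theorem rootVec_update_of_lt (hx : ∀ i, QComm (-cartanA j i) x (F i))
    (hF : SerreFamily F) {i : ℤ} {k : ℕ} (h : i + k + 1 = j) (m : ℕ) :
    rootVec (Function.update F j (F j + x)) i (k + m + 2) = rootVec F i (k + m + 2) := by
  induction m with
  | zero =>
    have h1 : QComm 1 x (F (j + 1)) := (hx _).congr_exp (by simp [cartanA])
    have h2 : Commute (rootVec F i k) (F (j + 1)) :=
      (hF.commute_rootVec_right k (by omega)).symm
    rw [add_zero, rootVec, rootVec_update_of_eq hx h, Function.update_of_ne (by push_cast; omega),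
      qbr_add_left, qbr_smul_left,
      show i + ((k + 1 : ℕ) : ℤ) + 1 = j + 1 by push_cast; omega, qbr_mul_left h2,
      h1.qbr_eq_zero, mul_zero, smul_zero, add_zero, rootVec.eq_2 F i (k + 1),
      show i + ((k + 1 : ℕ) : ℤ) + 1 = j + 1 by push_cast; omega]
  | succ m ih =>
    rw [show k + (m + 1) + 2 = k + m + 2 + 1 by ring, rootVec, ih,
      Function.update_of_ne (by push_cast; omega), ← rootVec]

end Update

end Prepend

/-- The root vector of `α_i + ⋯ + α_{i+k}` with the normalization used for the `F`'s. -/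
def fVec {B : Type*} [Ring B] [Algebra Kq B] (F : ℤ → B) (i : ℤ) (k : ℕ) : B :=
  (-qq⁻¹) ^ k • rootVec F i k

/-- The factor of the quasi `R`-matrix attached to `α_i + ⋯ + α_{i+k}`. -/
def rEntry {B B' : Type*} [Ring B] [Algebra Kq B] [Ring B'] [Algebra Kq B'] (E : ℤ → B)
    (F : ℤ → B') (i : ℤ) (k : ℕ) : PowerSeries (B ⊗[Kq] B') :=
  psiH (k + 1) (rootVec E i k ⊗ₜ[Kq] fVec F i k)

/-- The product of the first `m` factors of the quasi `R`-matrix attached to roots starting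
with `α_i`. -/
def rRow {B B' : Type*} [Ring B] [Algebra Kq B] [Ring B'] [Algebra Kq B'] (E : ℤ → B)
    (F : ℤ → B') (i : ℤ) (m : ℕ) : PowerSeries (B ⊗[Kq] B') :=
  ((List.range m).map (rEntry E F i)).prod

/-- The product of the first `m` rows of the quasi `R`-matrix of rank `n`. -/
def quasiR {B B' : Type*} [Ring B] [Algebra Kq B] [Ring B'] [Algebra Kq B'] (n : ℕ) (E : ℤ → B)
    (F : ℤ → B') (m : ℕ) : PowerSeries (B ⊗[Kq] B') :=
  ((List.range m).map fun i0 : ℕ => rRow E F ((i0 : ℤ) + 1) (n - i0)).prod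

/-- The sum of the letters of type `j` in a word of typed letters. -/
def wordSum {B : Type*} [AddCommMonoid B] (L : List (ℤ × B)) (j : ℤ) : B :=
  (L.map fun p => if p.1 = j then p.2 else 0).sum

theorem wordSum_cons {B : Type*} [AddCommMonoid B] (p : ℤ × B) (L : List (ℤ × B)) :
    wordSum (p :: L) = Function.update (wordSum L) p.1 (wordSum L p.1 + p.2) := by
  funext j
  rw [Function.update_apply]
  split_ifs with h
  · subst h
    simp [wordSum, add_comm]
  · simp [wordSum, Ne.symm h]

theorem wordSum_nil {B : Type*} [AddCommMonoid B] : wordSum ([] : List (ℤ × B)) = fun _ => 0 := rfl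

section QuasiR

variable {B B' : Type*} [Ring B] [Algebra Kq B] [Ring B'] [Algebra Kq B'] {E : ℤ → B}
  {F : ℤ → B'} {j : ℤ} {x : B'}

theorem QComm.refl (z : B) : QComm 0 z z := QComm.of_commute (Commute.refl z)

theorem rRow_succ (E : ℤ → B) (F : ℤ → B') (i : ℤ) (m : ℕ) :
    rRow E F i (m + 1) = rRow E F i m * rEntry E F i m := by
  simp [rRow, List.range_succ]

theorem quasiR_succ (n : ℕ) (E : ℤ → B) (F : ℤ → B') (m : ℕ) :
    quasiR n E F (m + 1) = quasiR n E F m * rRow E F ((m : ℤ) + 1) (n - m) := by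
  simp [quasiR, List.range_succ]

theorem rEntry_zero (E : ℤ → B) (i : ℤ) (k : ℕ) : rEntry E (fun _ => (0 : B')) i k = 1 := by
  rw [rEntry, fVec, rootVec_zero, smul_zero, TensorProduct.tmul_zero, psiH_zero _ (by omega)]

theorem rRow_zero (E : ℤ → B) (i : ℤ) (m : ℕ) : rRow E (fun _ => (0 : B')) i m = 1 := by
  induction m with
  | zero => simp [rRow]
  | succ m ih => rw [rRow_succ, ih, rEntry_zero, mul_one]

theorem quasiR_zero (n : ℕ) (E : ℤ → B) (m : ℕ) : quasiR n E (fun _ => (0 : B')) m = 1 := by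
  induction m with
  | zero => simp [quasiR]
  | succ m ih => rw [quasiR_succ, ih, rRow_zero, mul_one]

theorem psiH_mul_rEntry_far (hE : SerreFamily E) (hx : ∀ i, QComm (-cartanA j i) x (F i)) {i : ℤ}
    {k : ℕ} (h : i + k + 1 < j) :
    psiH 1 (E j ⊗ₜ[Kq] x) * rEntry E F i k =
      rEntry E (Function.update F j (F j + x)) i k * psiH 1 (E j ⊗ₜ[Kq] x) := by
  have e : rEntry E (Function.update F j (F j + x)) i k = rEntry E F i k := by
    unfold rEntry fVec
    rw [rootVec_congr (G := F) k fun l _ _ => Function.update_of_ne (by omega) _ _]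
  rw [e]
  refine psiH_commute ?_ _ _
  have h1 := QComm.of_commute (hE.commute_rootVec_right k h)
  have h2 := ((qcomm_rootVec hx (by omega : i < j) k).congr_exp (if_pos h)).smul_right
    ((-qq⁻¹) ^ k)
  exact ((h1.tmul h2).congr_exp (add_zero 0)).commute

theorem psiH_mul_rEntry_beyond (hE : SerreFamily E) (hF : SerreFamily F)
    (hx : ∀ i, QComm (-cartanA j i) x (F i)) {i : ℤ} {k : ℕ} (h : i + k + 1 = j) (m : ℕ) :
    psiH 1 (E j ⊗ₜ[Kq] x) * rEntry E F i (k + m + 2) =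
      rEntry E (Function.update F j (F j + x)) i (k + m + 2) * psiH 1 (E j ⊗ₜ[Kq] x) := by
  have e : rEntry E (Function.update F j (F j + x)) i (k + m + 2) = rEntry E F i (k + m + 2) := by
    unfold rEntry fVec
    rw [rootVec_update_of_lt hx hF h]
  rw [e]
  refine psiH_commute ?_ _ _
  have h1 := QComm.of_commute (hE.commute_rootVec_inner i k m)
  rw [h] at h1
  have h2 := ((qcomm_rootVec hx (by omega : i < j) (k + m + 2)).congr_exp (d := 0)
    (by push_cast; split_ifs <;> omega)).smul_right ((-qq⁻¹) ^ (k + m + 2))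
  exact ((h1.tmul h2).congr_exp (add_zero 0)).commute

theorem psiH_mul_rEntry_pair (hE : SerreFamily E) (hF : SerreFamily F)
    (hx : ∀ i, QComm (-cartanA j i) x (F i)) {i : ℤ} {k : ℕ} (h : i + k + 1 = j) :
    psiH 1 (E j ⊗ₜ[Kq] x) * (rEntry E F i k * rEntry E F i (k + 1)) =
      rEntry E (Function.update F j (F j + x)) i k *
        rEntry E (Function.update F j (F j + x)) i (k + 1) * psiH 1 (E j ⊗ₜ[Kq] x) := by
  have e : rEntry E (Function.update F j (F j + x)) i k = rEntry E F i k := by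
    unfold rEntry fVec
    rw [rootVec_congr (G := F) k fun l _ _ => Function.update_of_ne (by omega) _ _]
  have e' : fVec (Function.update F j (F j + x)) i (k + 1) =
      fVec F i k * x + fVec F i (k + 1) := by
    unfold fVec
    rw [rootVec_update_of_eq hx h, smul_add, smul_smul, pow_succ, mul_assoc, neg_mul_neg,
      inv_mul_cancel₀ qq_ne_zero, mul_one, smul_mul_assoc, add_comm]
  have hij : i < j := by omega
  have x1 : QComm 1 x (fVec F i k) := ((qcomm_rootVec hx hij k).congr_exp (by
    rw [if_neg (by omega), if_pos h])).smul_right _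
  have x2 : QComm (-1) x (fVec F i (k + 1)) := ((qcomm_rootVec hx hij (k + 1)).congr_exp (by
    push_cast; split_ifs <;> omega)).smul_right _
  have f1 : QComm 1 (fVec F i (k + 1)) (fVec F i k) :=
    ((hF.rootVec_qcomm_succ i k).symm.smul_right _).smul_left _
  have g1 : QComm 1 (rootVec E i (k + 1)) (rootVec E i k) := (hE.rootVec_qcomm_succ i k).symm
  have g2 : QComm 1 (E j) (rootVec E i (k + 1)) := by
    have := (hE.rootVec_succ_qcomm i k).symm
    rwa [h] at this
  have pent := psiH_pentagon (h := k + 1) (by omega) (u := rootVec E i k ⊗ₜ[Kq] fVec F i k)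
    (v := E j ⊗ₜ[Kq] x) (c := rootVec E i (k + 1) ⊗ₜ[Kq] (fVec F i k * x)) (by
      rw [Algebra.TensorProduct.tmul_mul_tmul, Algebra.TensorProduct.tmul_mul_tmul, x1.eq_one,
        TensorProduct.tmul_smul, TensorProduct.smul_tmul', ← TensorProduct.sub_tmul, rootVec, qbr,
        TensorProduct.smul_tmul', smul_smul, mul_inv_cancel₀ qq_sub_inv_ne_zero, one_smul, h])
    ((g1.tmul ((QComm.refl _).mul_left x1)).congr_exp (by norm_num))
    ((g2.tmul (x1.mul_right (QComm.refl _))).congr_exp (by norm_num))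
  have hcomm : Commute (psiH 1 (E j ⊗ₜ[Kq] x)) (rEntry E F i (k + 1)) :=
    psiH_commute ((g2.tmul x2).congr_exp (by norm_num)).commute _ _
  have hadd : psiH (k + 1 + 1) (rootVec E i (k + 1) ⊗ₜ[Kq] (fVec F i k * x)) *
      rEntry E F i (k + 1) = rEntry E (Function.update F j (F j + x)) i (k + 1) := by
    have := (QComm.refl (rootVec E i (k + 1))).tmul (f1.mul_right x2.symm)
    unfold rEntry
    rw [e', TensorProduct.tmul_add, psiH_add (by omega) (this.congr_exp (by norm_num))]
  rw [e, ← hadd, ← mul_assoc, show rEntry E F i k = psiH (k + 1) (rootVec E i k ⊗ₜ[Kq] fVec F i k)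
    from rfl, pent]
  simp only [mul_assoc]
  rw [hcomm.eq]

theorem psiH_mul_rRow_of_lt (hE : SerreFamily E) (hF : SerreFamily F)
    (hx : ∀ i, QComm (-cartanA j i) x (F i)) {i : ℤ} {m : ℕ} (hij : i < j) (hjm : j < i + m) :
    psiH 1 (E j ⊗ₜ[Kq] x) * rRow E F i m =
      rRow E (Function.update F j (F j + x)) i m * psiH 1 (E j ⊗ₜ[Kq] x) := by
  obtain ⟨k, hk⟩ : ∃ k : ℕ, i + k + 1 = j := ⟨(j - i - 1).toNat, by omega⟩
  obtain ⟨p, rfl⟩ : ∃ p : ℕ, m = k + 2 + p := ⟨m - (k + 2), by omega⟩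
  clear hjm
  have first : ∀ l : ℕ, l ≤ k → psiH 1 (E j ⊗ₜ[Kq] x) * rRow E F i l =
      rRow E (Function.update F j (F j + x)) i l * psiH 1 (E j ⊗ₜ[Kq] x) := by
    intro l
    induction l with
    | zero => simp [rRow]
    | succ l ih =>
      intro hl
      rw [rRow_succ, rRow_succ, ← mul_assoc, ih (by omega), mul_assoc,
        psiH_mul_rEntry_far hE hx (by omega), mul_assoc]
  induction p with
  | zero =>
    rw [add_zero, rRow_succ, rRow_succ, rRow_succ, rRow_succ, mul_assoc (rRow E F i k), ← mul_assoc,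
      first k le_rfl, mul_assoc, psiH_mul_rEntry_pair hE hF hx hk]
    simp only [mul_assoc]
  | succ p ih =>
    rw [← add_assoc, rRow_succ, rRow_succ, ← mul_assoc, ih, mul_assoc,
      show k + 2 + p = k + p + 2 by ring, psiH_mul_rEntry_beyond hE hF hx hk, mul_assoc]

theorem psiH_mul_rRow_self (hx : ∀ i, QComm (-cartanA j i) x (F i)) (m : ℕ) :
    psiH 1 (E j ⊗ₜ[Kq] x) * rRow E F j (m + 1) =
      rRow E (Function.update F j (F j + x)) j (m + 1) := by
  induction m with
  | zero =>
    have h : QComm 2 (F j) x := (hx j).symm.congr_exp (by simp [cartanA])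
    have h' := (QComm.refl (E j)).tmul h
    simp [rRow, rEntry, fVec, rootVec, add_comm (F j) x, TensorProduct.tmul_add,
      psiH_add one_pos (h'.congr_exp (zero_add 2))]
  | succ m ih =>
    rw [rRow_succ, ← mul_assoc, ih, rRow_succ _ _ _ (m + 1)]
    unfold rEntry fVec
    rw [rootVec_update_self hx]

theorem rRow_update_of_lt {i : ℤ} (h : j < i) (m : ℕ) :
    rRow E (Function.update F j (F j + x)) i m = rRow E F i m := by
  unfold rRow
  congr 1
  refine List.map_congr_left fun k _ => ?_
  unfold rEntry fVec
  rw [rootVec_congr (G := F) k fun l _ _ => Function.update_of_ne (by omega) _ _]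

/-- Adding `x` to `F_j` multiplies the quasi `R`-matrix by a quantum dilogarithm on the left. -/
theorem psiH_mul_quasiR (hE : SerreFamily E) (hF : SerreFamily F)
    (hx : ∀ i, QComm (-cartanA j i) x (F i)) {n : ℕ} (h1 : 1 ≤ j) (hn : j ≤ n) :
    psiH 1 (E j ⊗ₜ[Kq] x) * quasiR n E F n =
      quasiR n E (Function.update F j (F j + x)) n := by
  obtain ⟨d, rfl⟩ : ∃ d : ℕ, j = d + 1 := ⟨(j - 1).toNat, by omega⟩
  have before : ∀ m ≤ d, psiH 1 (E (d + 1) ⊗ₜ[Kq] x) * quasiR n E F m =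
      quasiR n E (Function.update F (d + 1) (F (d + 1) + x)) m * psiH 1 (E (d + 1) ⊗ₜ[Kq] x) := by
    intro m
    induction m with
    | zero => simp [quasiR]
    | succ m ih =>
      intro hm
      rw [quasiR_succ, quasiR_succ, ← mul_assoc, ih (by omega), mul_assoc,
        psiH_mul_rRow_of_lt hE hF hx (by omega) (by omega), mul_assoc]
  have after : ∀ m, psiH 1 (E (d + 1) ⊗ₜ[Kq] x) * quasiR n E F (d + 1 + m) =
      quasiR n E (Function.update F (d + 1) (F (d + 1) + x)) (d + 1 + m) := by
    intro m
    induction m with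
    | zero =>
      rw [add_zero, quasiR_succ, ← mul_assoc, before d le_rfl, mul_assoc,
        show n - d = (n - d - 1) + 1 by omega, psiH_mul_rRow_self hx,
        ← show n - d = (n - d - 1) + 1 by omega, quasiR_succ]
    | succ m ih =>
      rw [← add_assoc, quasiR_succ, ← mul_assoc, ih, quasiR_succ, rRow_update_of_lt (by omega)]
  have := after (n - (d + 1))
  rwa [show d + 1 + (n - (d + 1)) = n by omega] at this

theorem qcomm_wordSum {p : ℤ × B} {L : List (ℤ × B)}
    (h : ∀ r ∈ L, QComm (-cartanA p.1 r.1) p.2 r.2) (j : ℤ) :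
    QComm (-cartanA p.1 j) p.2 (wordSum L j) := by
  induction L with
  | nil => exact QComm.zero_right _ _
  | cons r L ih =>
    have ih := ih fun s hs => h s (List.mem_cons_of_mem _ hs)
    have hr := h r List.mem_cons_self
    rw [wordSum, List.map_cons, List.sum_cons]
    refine QComm.add_right ?_ ih
    split_ifs with hj
    · exact hj ▸ hr
    · exact QComm.zero_right _ _

theorem serreFamily_zero : SerreFamily (fun _ => (0 : B)) where
  commute _ _ _ := Commute.zero_left _
  serre_succ _ := by simp [QSerre]
  serre_pred _ := by simp [QSerre]

/-- A word of letters `x_1, x_2, …` of types `i_1, i_2, …` with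
`x_k x_l = q^{-(α_{i_k}, α_{i_l})} x_l x_k` for `k < l` gives a representation of the Serre
relations. -/
theorem serreFamily_wordSum {L : List (ℤ × B)}
    (hL : L.Pairwise fun p r => QComm (-cartanA p.1 r.1) p.2 r.2) :
    SerreFamily (wordSum L) := by
  induction L with
  | nil => exact serreFamily_zero
  | cons p L ih =>
    rw [List.pairwise_cons] at hL
    rw [wordSum_cons]
    exact (ih hL.2).update_add (qcomm_wordSum hL.1)

/-- The quasi `R`-matrix factors into quantum dilogarithms along a word of skew-commuting
letters. -/
theorem quasiR_wordSum (hE : SerreFamily E) {n : ℕ} {L : List (ℤ × B')}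
    (hL : L.Pairwise fun p r => QComm (-cartanA p.1 r.1) p.2 r.2)
    (hn : ∀ p ∈ L, 1 ≤ p.1 ∧ p.1 ≤ n) :
    quasiR n E (wordSum L) n = (L.map fun p => psiH 1 (E p.1 ⊗ₜ[Kq] p.2)).prod := by
  induction L with
  | nil => rw [wordSum_nil, quasiR_zero]; rfl
  | cons p L ih =>
    rw [List.pairwise_cons] at hL
    have hp := hn p List.mem_cons_self
    rw [wordSum_cons, ← psiH_mul_quasiR hE (serreFamily_wordSum hL.2) (qcomm_wordSum hL.1)
      hp.1 hp.2,
      ih hL.2 fun r hr => hn r (List.mem_cons_of_mem _ hr), List.map_cons, List.prod_cons]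

end QuasiR

theorem bind_pure_natCast (l : List ℕ) :
    (l >>= fun a : ℕ => pure (a : ℤ)) = l.map (Nat.cast : ℕ → ℤ) :=
  bind_pure_comp _ _

section ArrowCounts

theorem sum_range_ite_unique (n : ℕ) (P : ℕ → Prop) [DecidablePred P] (c : ℤ) (k₀ : ℕ)
    (h : ∀ k < n, P k → k = k₀) :
    ((List.range n).map fun k => if P k then c else 0).sum = if k₀ < n ∧ P k₀ then c else 0 := by
  induction n with
  | zero => simp
  | succ n ih =>
    rw [List.range_succ, List.map_append, List.sum_append, ih fun k hk => h k (by omega)]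
    have hn := h n (by omega)
    by_cases e : k₀ = n
    · subst e
      simp
    · have hP : ¬ P n := fun hP => e (hn hP).symm
      have : k₀ < n + 1 ↔ k₀ < n := by omega
      simp [hP, this]

theorem sum_range_range_ite_unique (n : ℕ) (m : ℕ → ℕ) (P : ℕ → ℕ → Prop)
    [∀ i, DecidablePred (P i)] (c : ℤ) (i₀ k₀ : ℕ)
    (h : ∀ i < n, ∀ k < m i, P i k → i = i₀ ∧ k = k₀) :
    ((List.range n).map fun i =>
      ((List.range (m i)).map fun k => if P i k then c else 0).sum).sum =
      if i₀ < n ∧ k₀ < m i₀ ∧ P i₀ k₀ then c else 0 := by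
  have e : ((List.range n).map fun i =>
      ((List.range (m i)).map fun k => if P i k then c else 0).sum) =
      (List.range n).map fun i => if k₀ < m i ∧ P i k₀ then c else 0 := by
    refine List.map_congr_left fun i hi => ?_
    exact sum_range_ite_unique _ _ _ _ fun k hk hP => (h i (List.mem_range.mp hi) k hk hP).2
  rw [e]
  exact sum_range_ite_unique _ _ _ _ fun i hi hP => (h i hi k₀ hP.1 hP.2).1

/-- The total doubled weight of the arrows from `u` to `v` in a list of weighted arrows. -/
def arrowCount (L : List (DnLabel × DnLabel × ℤ)) (u v : DnLabel) : ℤ :=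
  (L.map fun a => if a.1 = u ∧ a.2.1 = v then a.2.2 else 0).sum

theorem arrowCount_append (L L' : List (DnLabel × DnLabel × ℤ)) (u v : DnLabel) :
    arrowCount (L ++ L') u v = arrowCount L u v + arrowCount L' u v := by
  simp [arrowCount]

theorem arrowCount_flatMap {ι : Type*} (l : List ι) (f : ι → List (DnLabel × DnLabel × ℤ))
    (u v : DnLabel) :
    arrowCount (l.flatMap f) u v = (l.map fun i => arrowCount (f i) u v).sum := by
  induction l with
  | nil => rfl
  | cons i l ih => rw [List.flatMap_cons, arrowCount_append, ih, List.map_cons, List.sum_cons]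

theorem arrowCount_map (m : ℕ) (s t : ℕ → DnLabel) (c : ℤ) (u v : DnLabel) :
    arrowCount ((List.range m).map fun k => (s k, t k, c)) u v =
      ((List.range m).map fun k => if s k = u ∧ t k = v then c else 0).sum := by
  rw [arrowCount, List.map_map]
  rfl

theorem eps2_eq (n : ℕ) (u v : DnLabel) :
    eps2 n u v = arrowCount (dnArrows n) u v - arrowCount (dnArrows n) v u := by
  unfold eps2 arrowCount
  induction dnArrows n with
  | nil => rfl
  | cons a L ih =>
    simp only [List.map_cons, List.sum_cons, ih]
    ring

/-- The arrows along the `V`-paths. -/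
def IsVArrow (n : ℕ) : DnLabel → DnLabel → Prop
  | .V a b, .V a' b' => 1 ≤ a ∧ a ≤ n ∧ -a ≤ b ∧ b < a ∧ a' = a ∧ b' = b + 1
  | _, _ => False

/-- The arrows along the `Λ`-paths. -/
def IsLamArrow (n : ℕ) : DnLabel → DnLabel → Prop
  | .V a b, .V a' b' => (b < 0 ∧ a = a' + 1 ∧ b' = b ∧ a ≤ n ∧ -b ≤ a') ∨
      (0 < b ∧ a' = a + 1 ∧ b' = b ∧ b ≤ a ∧ a' ≤ n)
  | .V a b, .C s => a = n ∧ b = n + 1 - s ∧ 1 ≤ s ∧ s ≤ n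
  | .C s, .V a b => a = n ∧ b = -(n + 1 - s) ∧ 1 ≤ s ∧ s ≤ n
  | _, _ => False

/-- The dashed arrows along the left frozen column. -/
def IsLeftArrow (n : ℕ) : DnLabel → DnLabel → Prop
  | .V a b, .V a' b' => 1 ≤ a ∧ a < n ∧ b = -a ∧ a' = a + 1 ∧ b' = -a'
  | _, _ => False

/-- The dashed arrows along the right frozen column. -/
def IsRightArrow (n : ℕ) : DnLabel → DnLabel → Prop
  | .V a b, .V a' b' => 1 ≤ a' ∧ a' < n ∧ b = a ∧ a = a' + 1 ∧ b' = a'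
  | _, _ => False

/-- The arrows of the oriented cycles through the central column. -/
def IsCycleArrow (n : ℕ) : DnLabel → DnLabel → Prop
  | .V a b, .V a' b' => (a' = a + 1 ∧ b ≤ 0 ∧ b' = b - 1 ∧ 1 ≤ a + b ∧ a' ≤ n) ∨
      (a = a' + 1 ∧ b = b' + 1 ∧ 0 ≤ b' ∧ b' < a' ∧ a ≤ n)
  | .V a b, .C s => a = n ∧ b = s - n ∧ 1 ≤ s ∧ s < n
  | .C s, .V a b => a = n ∧ b = n - s ∧ 1 ≤ s ∧ s < n
  | _, _ => False

open Classical in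
theorem arrowCount_V (n : ℕ) (u v : DnLabel) :
    arrowCount ((List.range n).flatMap fun i0 =>
      (List.range (2 * i0 + 2)).map fun k =>
        (DnLabel.V ((i0 : ℤ) + 1) (-((i0 : ℤ) + 1) + k),
         DnLabel.V ((i0 : ℤ) + 1) (-((i0 : ℤ) + 1) + k + 1), 2)) u v =
      if IsVArrow n u v then 2 else 0 := by
  rw [arrowCount_flatMap]
  simp only [bind_pure_natCast, List.map_map, Function.comp_def, arrowCount_map]
  rcases u with ⟨a, b⟩ | s <;> rcases v with ⟨a', b'⟩ | s' <;>
    simp only [reduceCtorEq, and_false, false_and, if_false, List.map_const', List.sum_replicate,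
      smul_zero, DnLabel.V.injEq]
  · rw [sum_range_range_ite_unique _ _ _ _ (a - 1).toNat (b + a).toNat (by omega)]
    exact if_congr (by simp only [IsVArrow]; omega) rfl rfl
  all_goals exact (if_neg (by simp [IsVArrow])).symm

open Classical in
theorem arrowCount_Lam (n : ℕ) (u v : DnLabel) :
    arrowCount ((List.range n).flatMap fun i0 =>
      (List.range (2 * i0 + 2)).map fun k =>
        (Lam n ((i0 : ℤ) + 1) (-((i0 : ℤ) + 1) + k),
         Lam n ((i0 : ℤ) + 1) (-((i0 : ℤ) + 1) + k + 1), 2)) u v =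
      if IsLamArrow n u v then 2 else 0 := by
  have eV : ∀ i r a b : ℤ, Lam n i r = .V a b ↔
      (0 < r ∧ a = n + 1 - r ∧ b = -(n + 1 - i)) ∨ (r < 0 ∧ a = n + 1 + r ∧ b = n + 1 - i) := by
    intro i r a b
    unfold Lam th
    split_ifs <;> simp <;> omega
  have eC : ∀ i r s : ℤ, Lam n i r = .C s ↔ r = 0 ∧ s = i := by
    intro i r s
    unfold Lam th
    split_ifs <;> simp <;> omega
  rw [arrowCount_flatMap]
  simp only [bind_pure_natCast, List.map_map, Function.comp_def, arrowCount_map]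
  rcases u with ⟨a, b⟩ | s <;> rcases v with ⟨a', b'⟩ | s' <;> simp only [eV, eC]
  · rw [sum_range_range_ite_unique _ _ _ _ (if b < 0 then n + b else n - b).toNat
      (if b < 0 then n + b + 1 + (n + 1 - a) else a - b).toNat (by
        intro i hi k hk h; split_ifs <;> omega)]
    refine if_congr ?_ rfl rfl
    simp only [IsLamArrow]
    split_ifs <;> omega
  · rw [sum_range_range_ite_unique _ _ _ _ (s' - 1).toNat (s' - 1).toNat (by omega)]
    exact if_congr (by simp only [IsLamArrow]; omega) rfl rfl
  · rw [sum_range_range_ite_unique _ _ _ _ (s - 1).toNat s.toNat (by omega)]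
    exact if_congr (by simp only [IsLamArrow]; omega) rfl rfl
  · rw [sum_range_range_ite_unique _ _ _ _ 0 0 (by omega)]
    rw [if_neg (by omega)]
    exact (if_neg (by simp [IsLamArrow])).symm

open Classical in
theorem arrowCount_left (n : ℕ) (u v : DnLabel) :
    arrowCount ((List.range (n - 1)).map fun i0 =>
      (DnLabel.V ((i0 : ℤ) + 1) (-((i0 : ℤ) + 1)),
       DnLabel.V ((i0 : ℤ) + 2) (-((i0 : ℤ) + 2)), 1)) u v =
      if IsLeftArrow n u v then 1 else 0 := by
  simp only [bind_pure_natCast, List.map_map, Function.comp_def, arrowCount_map]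
  rcases u with ⟨a, b⟩ | s <;> rcases v with ⟨a', b'⟩ | s' <;>
    simp only [reduceCtorEq, and_false, false_and, if_false, List.map_const', List.sum_replicate,
      smul_zero, DnLabel.V.injEq]
  · rw [sum_range_ite_unique _ _ _ (a - 1).toNat (by omega)]
    exact if_congr (by simp only [IsLeftArrow]; omega) rfl rfl
  all_goals exact (if_neg (by simp [IsLeftArrow])).symm

open Classical in
theorem arrowCount_right (n : ℕ) (u v : DnLabel) :
    arrowCount ((List.range (n - 1)).map fun i0 =>
      (DnLabel.V ((i0 : ℤ) + 2) ((i0 : ℤ) + 2),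
       DnLabel.V ((i0 : ℤ) + 1) ((i0 : ℤ) + 1), 1)) u v =
      if IsRightArrow n u v then 1 else 0 := by
  simp only [bind_pure_natCast, List.map_map, Function.comp_def, arrowCount_map]
  rcases u with ⟨a, b⟩ | s <;> rcases v with ⟨a', b'⟩ | s' <;>
    simp only [reduceCtorEq, and_false, false_and, if_false, List.map_const', List.sum_replicate,
      smul_zero, DnLabel.V.injEq]
  · rw [sum_range_ite_unique _ _ _ (a' - 1).toNat (by omega)]
    exact if_congr (by simp only [IsRightArrow]; omega) rfl rfl
  all_goals exact (if_neg (by simp [IsRightArrow])).symm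

open Classical in
theorem arrowCount_cycle (n : ℕ) (u v : DnLabel) :
    arrowCount ((List.range (n - 1)).flatMap fun i0 =>
      (((List.range (n - 1 - i0)).map fun k =>
          (DnLabel.V ((i0 : ℤ) + 1 + k) (-(k : ℤ)),
           DnLabel.V ((i0 : ℤ) + 2 + k) (-(k : ℤ) - 1), 2))
        ++ [(DnLabel.V (n : ℤ) ((i0 : ℤ) + 1 - n), DnLabel.C ((i0 : ℤ) + 1), 2),
            (DnLabel.C ((i0 : ℤ) + 1), DnLabel.V (n : ℤ) ((n : ℤ) - (i0 + 1)), 2)]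
        ++ ((List.range (n - 1 - i0)).map fun k =>
          (DnLabel.V ((i0 : ℤ) + 2 + k) ((k : ℤ) + 1),
           DnLabel.V ((i0 : ℤ) + 1 + k) (k : ℤ), 2)))) u v =
      if IsCycleArrow n u v then 2 else 0 := by
  rw [arrowCount_flatMap]
  simp only [bind_pure_natCast, List.map_map, Function.comp_def, arrowCount_append, arrowCount_map,
    List.sum_map_add]
  rcases u with ⟨a, b⟩ | s <;> rcases v with ⟨a', b'⟩ | s' <;>
    simp only [arrowCount, List.map_cons, List.map_nil, List.sum_cons, List.sum_nil, reduceCtorEq,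
      and_false, false_and, if_false, List.map_const', List.sum_replicate, smul_zero,
      DnLabel.V.injEq, DnLabel.C.injEq, add_zero, zero_add]
  · rw [sum_range_range_ite_unique _ _ _ _ (a + b - 1).toNat (-b).toNat (by omega),
      sum_range_range_ite_unique _ _ _ _ (a' - b' - 1).toNat b'.toNat (by omega)]
    rw [if_congr (show _ ↔ a' = a + 1 ∧ b ≤ 0 ∧ b' = b - 1 ∧ 1 ≤ a + b ∧ a' ≤ n by omega) rfl rfl,
      if_congr (show (a' - b' - 1).toNat < n - 1 ∧ _ ↔
        a = a' + 1 ∧ b = b' + 1 ∧ 0 ≤ b' ∧ b' < a' ∧ a ≤ n by omega) rfl rfl]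
    simp only [IsCycleArrow]
    split_ifs <;> omega
  · rw [sum_range_ite_unique _ _ _ (s' - 1).toNat (by omega)]
    exact if_congr (by simp only [IsCycleArrow]; omega) rfl rfl
  · rw [sum_range_ite_unique _ _ _ (s - 1).toNat (by omega)]
    exact if_congr (by simp only [IsCycleArrow]; omega) rfl rfl
  · exact (if_neg (by simp [IsCycleArrow])).symm

open Classical in
theorem arrowCount_dnArrows (n : ℕ) (u v : DnLabel) :
    arrowCount (dnArrows n) u v = (if IsVArrow n u v then 2 else 0) +
      (if IsLamArrow n u v then 2 else 0) + (if IsLeftArrow n u v then 1 else 0) +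
      (if IsRightArrow n u v then 1 else 0) + (if IsCycleArrow n u v then 2 else 0) := by
  unfold dnArrows
  rw [arrowCount_append, arrowCount_append, arrowCount_append, arrowCount_append, arrowCount_V,
    arrowCount_Lam, arrowCount_left, arrowCount_right, arrowCount_cycle]

end ArrowCounts

/-- The doubled number of arrows from the `a`-th vertex of the `i`-th path to the `b`-th vertex of
the `i'`-th path, for the `V`-paths as well as for the `Λ`-paths. -/
def pathArrows (i a i' b : ℤ) : ℤ :=
  (if i' = i ∧ b = a + 1 then 2 else 0) +
  (if (b = a ∧ a < 0 ∧ i = i' + 1) ∨ (b = a ∧ 0 < a ∧ i' = i + 1) then 2 else 0) +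
  (if i' = i + 1 ∧ a = -i ∧ b = -i' then 1 else 0) +
  (if i = i' + 1 ∧ a = i ∧ b = i' then 1 else 0) +
  (if (i' = i + 1 ∧ a ≤ 0 ∧ a ≠ -i ∧ b = a - 1) ∨
    (i = i' + 1 ∧ a = b + 1 ∧ 0 ≤ b ∧ b ≠ i') then 2 else 0)

section PathArrows

variable {n : ℕ} {i a i' b : ℤ}

theorem arrowCount_V_V (hi : 1 ≤ i) (hin : i ≤ n) (ha : -i ≤ a) (ha' : a ≤ i) (hi' : 1 ≤ i')
    (hin' : i' ≤ n) (hb : -i' ≤ b) (hb' : b ≤ i') :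
    arrowCount (dnArrows n) (.V i a) (.V i' b) = pathArrows i a i' b := by
  classical
  rw [arrowCount_dnArrows]
  unfold pathArrows
  refine congrArg₂ (· + ·) (congrArg₂ (· + ·) (congrArg₂ (· + ·) (congrArg₂ (· + ·) ?_ ?_) ?_) ?_)
    ?_ <;> refine if_congr ?_ rfl rfl
  · simp only [IsVArrow]
    omega
  · simp only [IsLamArrow]
    omega
  · simp only [IsLeftArrow]
    omega
  · simp only [IsRightArrow]
    omega
  · simp only [IsCycleArrow]
    omega

theorem arrowCount_Lam_Lam (hi : 1 ≤ i) (hin : i ≤ n) (ha : -i ≤ a) (ha' : a ≤ i) (hi' : 1 ≤ i')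
    (hin' : i' ≤ n) (hb : -i' ≤ b) (hb' : b ≤ i') :
    arrowCount (dnArrows n) (Lam n i a) (Lam n i' b) = pathArrows i a i' b := by
  have perm : ∀ a b c d e a' b' c' d' e' : ℤ, a = b' → b = a' → c = d' → d = c' → e = e' →
      a + b + c + d + e = a' + b' + c' + d' + e' := by omega
  classical
  rw [arrowCount_dnArrows]
  unfold pathArrows Lam th
  apply perm <;> refine if_congr ?_ rfl rfl
  · split_ifs <;> simp [IsVArrow] <;> omega
  · split_ifs <;> simp [IsLamArrow] <;> omega
  · split_ifs <;> simp [IsLeftArrow] <;> omega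
  · split_ifs <;> simp [IsRightArrow] <;> omega
  · split_ifs <;> simp [IsCycleArrow] <;> omega

end PathArrows

/-- The exponent by which the `a`-th generator of the `i`-th path passes the partial product,
ending in position `r`, of the `i+1`-st path. -/
def pathStepExp (i a r : ℤ) : ℤ :=
  if a = -i then (if r = -i - 1 then -1 else if -i ≤ r then 1 else 0)
  else if a < 0 then (if r = a - 1 then -2 else 0)
  else if a = 0 then (if r = -1 ∨ r = 0 then -2 else 0)
  else if r = a then -2 else 0

theorem pathArrows_succ_sub {i a b : ℤ} (hi : 1 ≤ i) (ha : -i ≤ a) (ha' : a < i) (hb : -(i + 1) ≤ b)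
    (hb' : b ≤ i) :
    pathStepExp i a (b - 1) + (pathArrows (i + 1) b i a - pathArrows i a (i + 1) b) =
      pathStepExp i a b := by
  have h1 : pathArrows (i + 1) b i a = if (b = a ∧ a < 0) ∨ (b = a + 1 ∧ 0 ≤ a) then 2 else 0 := by
    unfold pathArrows
    split_ifs <;> omega
  have h2 : pathArrows i a (i + 1) b = if a = -i ∧ b = -i - 1 then 1 else
      if (b = a ∧ 0 < a) ∨ (a ≤ 0 ∧ a ≠ -i ∧ b = a - 1) then 2 else 0 := by
    unfold pathArrows
    split_ifs <;> omega
  rw [h1, h2]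
  unfold pathStepExp
  split_ifs <;> omega

/-- The exponent by which the `a`-th generator of the `i`-th path passes the partial product,
ending in position `r`, of the same path. -/
def pathSelfExp (i a r : ℤ) : ℤ :=
  (if -i < a ∧ a - 1 ≤ r then 2 else 0) - (if a + 1 ≤ r then 2 else 0)

theorem pathArrows_self_sub {i a b : ℤ} (hb : -i ≤ b) :
    pathSelfExp i a (b - 1) + (pathArrows i b i a - pathArrows i a i b) = pathSelfExp i a b := by
  have h : ∀ x y, pathArrows i x i y = if y = x + 1 then 2 else 0 := by
    intro x y
    unfold pathArrows
    split_ifs <;> omega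
  rw [h, h]
  unfold pathSelfExp
  split_ifs <;> omega

theorem pathArrows_far {i a i' b : ℤ} (h : i + 1 < i') :
    pathArrows i' b i a - pathArrows i a i' b = 0 := by
  unfold pathArrows
  repeat rw [if_neg (by omega)]
  norm_num

/-- The ordered product of the first `m` generators of the `i`-th path. -/
def pathProd {B : Type*} [Monoid B] (G : ℤ → ℤ → B) (i : ℤ) (m : ℕ) : B :=
  ((List.range m).map fun k : ℕ => G i (-i + k)).prod

theorem pathProd_succ {B : Type*} [Monoid B] (G : ℤ → ℤ → B) (i : ℤ) (m : ℕ) :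
    pathProd G i (m + 1) = pathProd G i m * G i (-i + m) := by
  simp [pathProd, List.range_succ]

theorem pathProd_zero {B : Type*} [Monoid B] (G : ℤ → ℤ → B) (i : ℤ) : pathProd G i 0 = 1 := rfl

/-- A family of generators arranged in paths which skew-commute according to the arrows between
them. -/
def PathRelations {B : Type*} [Ring B] [Algebra Kq B] (n : ℕ) (G : ℤ → ℤ → B) : Prop :=
  ∀ i a i' b : ℤ, 1 ≤ i → i ≤ n → -i ≤ a → a ≤ i → 1 ≤ i' → i' ≤ n → -i' ≤ b → b ≤ i' →
    QComm (pathArrows i' b i a - pathArrows i a i' b) (G i a) (G i' b)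

namespace PathRelations

variable {B : Type*} [Ring B] [Algebra Kq B] {n : ℕ} {G : ℤ → ℤ → B}

theorem gen_pathProd_succ (hG : PathRelations n G) {i a : ℤ} (hi : 1 ≤ i) (hin : i + 1 ≤ n)
    (ha : -i ≤ a) (ha' : a < i) (m : ℕ) (hm : m ≤ 2 * (i + 1)) :
    QComm (pathStepExp i a (m - i - 2)) (G i a) (pathProd G (i + 1) m) := by
  induction m with
  | zero =>
    refine (QComm.of_commute (Commute.one_right (G i a))).congr_exp ?_
    unfold pathStepExp
    push_cast
    split_ifs <;> omega
  | succ m ih =>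
    rw [pathProd_succ]
    push_cast at hm
    refine ((ih (by omega)).mul_right (hG i a (i + 1) (-(i + 1) + m) hi (by omega) ha (by omega)
      (by omega) hin (by omega) (by omega))).congr_exp ?_
    have := pathArrows_succ_sub (i := i) (a := a) (b := -(i + 1) + m) hi ha ha' (by omega)
      (by omega)
    rw [show (m : ℤ) - i - 2 = -(i + 1) + m - 1 by ring, this]
    congr 1
    push_cast
    ring

theorem gen_pathProd_self (hG : PathRelations n G) {i a : ℤ} (hi : 1 ≤ i) (hin : i ≤ n)
    (ha : -i ≤ a) (ha' : a ≤ i) (m : ℕ) (hm : m ≤ 2 * i) :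
    QComm (pathSelfExp i a (m - i - 1)) (G i a) (pathProd G i m) := by
  induction m with
  | zero =>
    refine (QComm.of_commute (Commute.one_right (G i a))).congr_exp ?_
    unfold pathSelfExp
    push_cast
    split_ifs <;> omega
  | succ m ih =>
    rw [pathProd_succ]
    push_cast at hm
    refine ((ih (by omega)).mul_right (hG i a i (-i + m) hi hin ha ha' hi hin (by omega)
      (by omega))).congr_exp ?_
    have := pathArrows_self_sub (i := i) (a := a) (b := -i + m) (by omega)
    rw [show (m : ℤ) - i - 1 = -i + m - 1 by ring, this]
    congr 1
    push_cast
    ring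

theorem pathProd_self (hG : PathRelations n G) {i : ℤ} (hi : 1 ≤ i) (hin : i ≤ n) {l m : ℕ}
    (hl : 1 ≤ l) (hlm : l < m) (hm : m ≤ 2 * i) :
    QComm (-2) (pathProd G i l) (pathProd G i m) := by
  induction l, hl using Nat.le_induction with
  | base =>
    rw [pathProd_succ, pathProd_zero, one_mul]
    refine (hG.gen_pathProd_self hi hin (by simp) (by push_cast; omega) m hm).congr_exp ?_
    unfold pathSelfExp
    push_cast
    split_ifs <;> omega
  | succ l hl ih =>
    rw [pathProd_succ]
    refine ((ih (by omega)).mul_left (hG.gen_pathProd_self hi hin (by omega) (by omega) m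
      hm)).congr_exp ?_
    unfold pathSelfExp
    split_ifs <;> omega

theorem pathProd_succ_path (hG : PathRelations n G) {i : ℤ} (hi : 1 ≤ i) (hin : i + 1 ≤ n)
    {l m : ℕ} (hl : 1 ≤ l) (hli : l ≤ 2 * i) (hm1 : 1 ≤ m) (hm : m ≤ 2 * (i + 1)) :
    QComm (if l + 1 < m ∨ ((l : ℤ) + 1 = m ∧ l ≤ i) then 1 else -1) (pathProd G i l)
      (pathProd G (i + 1) m) := by
  induction l, hl using Nat.le_induction with
  | base =>
    rw [pathProd_succ, pathProd_zero, one_mul]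
    refine (hG.gen_pathProd_succ hi hin (by simp) (by push_cast; omega) m hm).congr_exp ?_
    unfold pathStepExp
    push_cast
    split_ifs <;> omega
  | succ l hl ih =>
    rw [pathProd_succ]
    push_cast at hli
    refine ((ih (by omega)).mul_left (hG.gen_pathProd_succ hi hin (by omega) (by omega) m
      hm)).congr_exp ?_
    unfold pathStepExp
    push_cast
    split_ifs <;> omega

theorem pathProd_far (hG : PathRelations n G) {i i' : ℤ} (hi : 1 ≤ i) (hii : i + 1 < i')
    (hin : i' ≤ n) {l m : ℕ} (hl : l ≤ 2 * i) (hm : m ≤ 2 * i') :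
    Commute (pathProd G i l) (pathProd G i' m) := by
  refine Commute.list_prod_left _ _ fun y hy => Commute.list_prod_right _ _ fun z hz => ?_
  obtain ⟨k, hk, rfl⟩ := List.mem_map.mp hy
  obtain ⟨k', hk', rfl⟩ := List.mem_map.mp hz
  rw [List.mem_range] at hk hk'
  exact ((hG _ _ _ _ hi (by omega) (by omega) (by omega) (by omega) hin (by omega)
    (by omega)).congr_exp (pathArrows_far hii)).commute

end PathRelations

theorem Xg_qcomm {n : ℕ} {u v : DnLabel} (hu : u.valid n) (hv : v.valid n) :
    QComm (eps2 n v u) (Xg n u) (Xg n v) := by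
  unfold QComm Xg
  rw [dif_pos hu, dif_pos hv, ← map_mul, ← map_mul, ← map_smul]
  exact RingQuot.mkAlgHom_rel Kq (DnRel.comm ⟨u, hu⟩ ⟨v, hv⟩)

theorem Lam_valid {n : ℕ} {i a : ℤ} (hi : 1 ≤ i) (hin : i ≤ n) (ha : -i ≤ a) (ha' : a ≤ i) :
    (Lam n i a).valid n := by
  unfold Lam th
  split_ifs <;> simp only [DnLabel.valid] <;> omega

theorem pathRelations_V (n : ℕ) : PathRelations n fun i a => Xg n (.V i a) := by
  intro i a i' b hi hin ha ha' hi' hin' hb hb'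
  rw [← arrowCount_V_V hi hin ha ha' hi' hin' hb hb',
    ← arrowCount_V_V hi' hin' hb hb' hi hin ha ha', ← eps2_eq]
  exact Xg_qcomm ⟨hi, hin, ha, ha'⟩ ⟨hi', hin', hb, hb'⟩

theorem pathRelations_Lam (n : ℕ) : PathRelations n fun i a => Xg n (Lam n i a) := by
  intro i a i' b hi hin ha ha' hi' hin' hb hb'
  rw [← arrowCount_Lam_Lam hi hin ha ha' hi' hin' hb hb',
    ← arrowCount_Lam_Lam hi' hin' hb hb' hi hin ha ha', ← eps2_eq]
  exact Xg_qcomm (Lam_valid hi hin ha ha') (Lam_valid hi' hin' hb hb')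

theorem Vprod_eq (n : ℕ) (i r : ℤ) :
    Vprod n i r = pathProd (fun i a => Xg n (.V i a)) i (r + i + 1).toNat := by
  simp only [Vprod, pathProd, bind_pure_natCast, List.map_map, Function.comp_def]

theorem Lprod_eq (n : ℕ) (i r : ℤ) :
    Lprod n i r = pathProd (fun i a => Xg n (Lam n i a)) i (r + i + 1).toNat := by
  simp only [Lprod, pathProd, bind_pure_natCast, List.map_map, Function.comp_def]

/-- The skew-commutation relations between the letters `f i r`, for `-i ≤ r < i`. -/
structure LetterRelations {B : Type*} [Ring B] [Algebra Kq B] (n : ℕ) (f : ℤ → ℤ → B) :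
    Prop where
  self : ∀ i r r' : ℤ, 1 ≤ i → i ≤ n → -i ≤ r → r < r' → r' < i → QComm (-2) (f i r) (f i r')
  succ : ∀ i r r' : ℤ, 1 ≤ i → i + 1 ≤ n → -i ≤ r → r < i → -(i + 1) ≤ r' → r' < i + 1 →
    QComm (if r < r' ∨ (r = r' ∧ r < 0) then 1 else -1) (f i r) (f (i + 1) r')
  far : ∀ i i' r r' : ℤ, 1 ≤ i → i + 1 < i' → i' ≤ n → -i ≤ r → r < i → -i' ≤ r' → r' < i' →
    Commute (f i r) (f i' r')

theorem PathRelations.letterRelations {B : Type*} [Ring B] [Algebra Kq B] {n : ℕ}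
    {G : ℤ → ℤ → B} (hG : PathRelations n G) (c : ℤ → ℤ → Kq) :
    LetterRelations n fun i r => c i r • pathProd G i (r + i + 1).toNat where
  self i r r' hi hin hr hrr hr' :=
    ((hG.pathProd_self hi hin (by omega) (by omega) (by omega)).smul_left _).smul_right _
  succ i r r' hi hin hr hri hr' hri' := by
    refine (((hG.pathProd_succ_path hi hin (l := (r + i + 1).toNat)
      (m := (r' + (i + 1) + 1).toNat) (by omega) (by omega) (by omega)
      (by omega)).smul_left _).smul_right _).congr_exp ?_
    split_ifs <;> omega
  far i i' r r' hi hii hin hr hri hr' hri' :=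
    (((QComm.of_commute (hG.pathProd_far hi hii hin (l := (r + i + 1).toNat)
      (m := (r' + i' + 1).toNat) (by omega) (by omega))).smul_left _).smul_right _).commute

theorem letterRelations_ww (n : ℕ) : LetterRelations n (ww n) := by
  have := (pathRelations_V n).letterRelations fun i r => ii * qq ^ (i + r)
  simp only [← Vprod_eq] at this
  exact this

theorem letterRelations_mm (n : ℕ) : LetterRelations n (mm n) := by
  have := (pathRelations_Lam n).letterRelations fun i r => ii * qq ^ (i + r)
  simp only [← Lprod_eq] at this
  exact this

/-- The indices `(i, r)` with `r < 0`, in the order in which they occur in the factorization. -/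
def negWord (n : ℕ) : List (ℤ × ℤ) :=
  (List.range n).flatMap fun k0 => (List.range (n - k0)).map fun j0 : ℕ =>
    (th n ((j0 : ℤ) + 1), ((k0 : ℤ) + 1) - th n ((j0 : ℤ) + 1) - 1)

/-- The indices `(i, r)` with `0 ≤ r`, in the order in which they occur in the factorization. -/
def posWord (n : ℕ) : List (ℤ × ℤ) :=
  (List.range n).flatMap fun k0 => (List.range (k0 + 1)).map fun j1 : ℕ =>
    ((n : ℤ) - k0 + j1, ((n : ℤ) - k0 + j1) - th n ((k0 : ℤ) + 1))

/-- The indices `(i, r)` in the order in which they occur in the factorization. -/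
def indexWord (n : ℕ) : List (ℤ × ℤ) := negWord n ++ posWord n

theorem mem_negWord {n : ℕ} {p : ℤ × ℤ} :
    p ∈ negWord n ↔ 1 ≤ p.1 ∧ p.1 ≤ n ∧ -p.1 ≤ p.2 ∧ p.2 < 0 := by
  obtain ⟨i, r⟩ := p
  simp only [negWord, th, List.mem_flatMap, List.mem_map, List.mem_range, Prod.mk.injEq]
  constructor
  · rintro ⟨k, hk, j, hj, rfl, rfl⟩
    omega
  · rintro ⟨h1, h2, h3, h4⟩
    exact ⟨(r + i).toNat, by omega, (n - i).toNat, by omega, by omega, by omega⟩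

theorem mem_posWord {n : ℕ} {p : ℤ × ℤ} :
    p ∈ posWord n ↔ 1 ≤ p.1 ∧ p.1 ≤ n ∧ 0 ≤ p.2 ∧ p.2 < p.1 := by
  obtain ⟨i, r⟩ := p
  simp only [posWord, th, List.mem_flatMap, List.mem_map, List.mem_range, Prod.mk.injEq]
  constructor
  · rintro ⟨k, hk, j, hj, rfl, rfl⟩
    omega
  · rintro ⟨h1, h2, h3, h4⟩
    exact ⟨(n + r - i).toNat, by omega, r.toNat, by omega, by omega, by omega⟩

theorem mem_indexWord {n : ℕ} {p : ℤ × ℤ} :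
    p ∈ indexWord n ↔ 1 ≤ p.1 ∧ p.1 ≤ n ∧ -p.1 ≤ p.2 ∧ p.2 < p.1 := by
  rw [indexWord, List.mem_append, mem_negWord, mem_posWord]
  omega

theorem pairwise_flatMap_range {α : Type*} {R : α → α → Prop} {n : ℕ} {N : ℕ → ℕ}
    {g : ℕ → ℕ → α} (h : ∀ k, ∀ j j', j < j' → R (g k j) (g k j'))
    (h' : ∀ k k', k < k' → ∀ j < N k, ∀ j' < N k', R (g k j) (g k' j')) :
    ((List.range n).flatMap fun k => (List.range (N k)).map (g k)).Pairwise R := by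
  rw [List.pairwise_flatMap]
  refine ⟨fun k _ => List.pairwise_map.mpr (List.pairwise_lt_range.imp fun {j j'} hj =>
      h k j j' hj),
    List.pairwise_lt_range.imp fun {k k'} hk x hx y hy => ?_⟩
  obtain ⟨j, hj, rfl⟩ := List.mem_map.mp hx
  obtain ⟨j', hj', rfl⟩ := List.mem_map.mp hy
  exact h' k k' hk j (List.mem_range.mp hj) j' (List.mem_range.mp hj')

/-- The order in which the indices `(i, r)` occur in the factorization. -/
def IndexLT (p p' : ℤ × ℤ) : Prop :=
  (p.2 < 0 ∧ 0 ≤ p'.2) ∨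
  (p.2 < 0 ∧ p'.2 < 0 ∧ (p.1 + p.2 < p'.1 + p'.2 ∨ (p.1 + p.2 = p'.1 + p'.2 ∧ p'.1 < p.1))) ∨
  (0 ≤ p.2 ∧ 0 ≤ p'.2 ∧ (p.2 - p.1 < p'.2 - p'.1 ∨ (p.2 - p.1 = p'.2 - p'.1 ∧ p.1 < p'.1)))

theorem pairwise_indexWord (n : ℕ) : (indexWord n).Pairwise IndexLT := by
  rw [indexWord, List.pairwise_append]
  refine ⟨?_, ?_, fun p hp p' hp' => ?_⟩
  · have : (negWord n).Pairwise fun p p' : ℤ × ℤ =>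
        p.1 + p.2 < p'.1 + p'.2 ∨ (p.1 + p.2 = p'.1 + p'.2 ∧ p'.1 < p.1) := by
      refine pairwise_flatMap_range (fun k j j' hj => ?_) fun k k' hk j hj j' hj' => ?_
      all_goals
        simp only [th]
        omega
    refine this.imp_of_mem fun {p p'} hp hp' h => ?_
    rw [mem_negWord] at hp hp'
    exact Or.inr (Or.inl ⟨by omega, by omega, h⟩)
  · have : (posWord n).Pairwise fun p p' : ℤ × ℤ =>
        p.2 - p.1 < p'.2 - p'.1 ∨ (p.2 - p.1 = p'.2 - p'.1 ∧ p.1 < p'.1) := by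
      refine pairwise_flatMap_range (fun k j j' hj => ?_) fun k k' hk j hj j' hj' => ?_
      all_goals
        simp only [th]
        omega
    refine this.imp_of_mem fun {p p'} hp hp' h => ?_
    rw [mem_posWord] at hp hp'
    exact Or.inr (Or.inr ⟨by omega, by omega, h⟩)
  · rw [mem_negWord] at hp
    rw [mem_posWord] at hp'
    exact Or.inl ⟨by omega, by omega⟩

theorem nodup_indexWord (n : ℕ) : (indexWord n).Nodup := by
  refine (pairwise_indexWord n).imp fun {p p'} h => ?_
  rintro rfl
  unfold IndexLT at h
  omega

/-- The word of typed letters of the factorization. -/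
def letterWord {B : Type*} (n : ℕ) (f : ℤ → ℤ → B) : List (ℤ × B) :=
  (indexWord n).map fun p => (th n p.1, f p.1 p.2)

section LetterWord

variable {B : Type*} [Ring B] [Algebra Kq B] {n : ℕ} {f : ℤ → ℤ → B}

theorem LetterRelations.pairwise_letterWord (hf : LetterRelations n f) :
    (letterWord n f).Pairwise fun p p' => QComm (-cartanA p.1 p'.1) p.2 p'.2 := by
  rw [letterWord, List.pairwise_map]
  refine (pairwise_indexWord n).imp_of_mem ?_
  rintro ⟨i, r⟩ ⟨i', r'⟩ hp hp' h
  rw [mem_indexWord] at hp hp'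
  simp only [IndexLT] at h hp hp' ⊢
  rcases lt_trichotomy i i' with hi | rfl | hi
  · rcases (show i + 1 ≤ i' by omega).eq_or_lt with rfl | hi'
    · refine (hf.succ i r r' ?_ ?_ ?_ ?_ ?_ ?_).congr_exp ?_
      on_goal 7 =>
        unfold cartanA th
        split_ifs
      all_goals omega
    · refine (QComm.of_commute (hf.far i i' r r' ?_ ?_ ?_ ?_ ?_ ?_ ?_)).congr_exp ?_
      on_goal 8 =>
        unfold cartanA th
        split_ifs
      all_goals omega
  · refine (hf.self i r r' ?_ ?_ ?_ ?_ ?_).congr_exp ?_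
    on_goal 6 => simp [cartanA]
    all_goals omega
  · rcases (show i' + 1 ≤ i by omega).eq_or_lt with rfl | hi'
    · refine (hf.succ i' r' r ?_ ?_ ?_ ?_ ?_ ?_).symm.congr_exp ?_
      on_goal 7 =>
        unfold cartanA th
        split_ifs
      all_goals omega
    · refine (QComm.of_commute (hf.far i' i r' r ?_ ?_ ?_ ?_ ?_ ?_ ?_).symm).congr_exp ?_
      on_goal 8 =>
        unfold cartanA th
        split_ifs
      all_goals omega

theorem wordSum_letterWord {B : Type*} [Ring B] {n : ℕ} (f : ℤ → ℤ → B) {j : ℤ} (hj : 1 ≤ j)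
    (hjn : j ≤ n) :
    wordSum (letterWord n f) j = ∑ r ∈ Finset.Icc (-th n j) (th n j - 1), f (th n j) r := by
  rw [wordSum, letterWord, List.map_map, ← List.sum_toFinset _ (nodup_indexWord n)]
  simp only [Function.comp_def]
  rw [← Finset.sum_filter]
  refine (Finset.sum_bij' (fun r _ => (th n j, r)) (fun p _ => p.2) ?_ ?_ ?_ ?_ ?_).symm
  · intro r hr
    rw [Finset.mem_Icc] at hr
    rw [Finset.mem_filter, List.mem_toFinset, mem_indexWord]
    simp only [th] at hr ⊢
    omega
  · intro p hp
    rw [Finset.mem_filter, List.mem_toFinset, mem_indexWord] at hp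
    rw [Finset.mem_Icc]
    simp only [th] at hp ⊢
    omega
  · intro r _
    rfl
  · rintro ⟨i, r⟩ hp
    rw [Finset.mem_filter] at hp
    simp only [th, Prod.mk.injEq, and_true] at hp ⊢
    omega
  · intro r _
    rfl

theorem SerreFamily.reflect {E : ℤ → B} (hE : SerreFamily E) (c : ℤ) :
    SerreFamily fun i => E (c - i) where
  commute i j h := (hE.commute (c - j) (c - i) (by omega)).symm
  serre_succ i := by
    have := hE.serre_pred (c - (i + 1))
    rwa [show c - (i + 1) + 1 = c - i by ring] at this
  serre_pred i := by
    have := hE.serre_succ (c - (i + 1))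
    rwa [show c - (i + 1) + 1 = c - i by ring] at this

/-- A product of quantum dilogarithms of pairwise skew-commuting elements is the quantum
dilogarithm of their sum. -/
theorem psiH_sum_range {h : ℕ} (hh : 0 < h) (g : ℕ → B) (N : ℕ)
    (hg : ∀ a b, a < b → b < N → QComm (-2) (g a) (g b)) :
    ((List.range N).map fun a => psiH h (g a)).prod = psiH h (∑ a ∈ Finset.range N, g a) := by
  induction N with
  | zero => simp [psiH_zero h hh]
  | succ N ih =>
    rw [List.range_succ, List.map_append, List.prod_append,
      ih fun a b hab hb => hg a b hab (by omega), Finset.sum_range_succ, psiH_add hh]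
    · simp
    · refine Finset.sum_induction _ (QComm 2 (g N)) (fun _ _ => QComm.add_right)
        (QComm.zero_right _ _) fun a ha => ?_
      exact (hg a N (Finset.mem_range.mp ha) (by omega)).symm

end LetterWord

theorem EEaux_eq (n : ℕ) {i : ℤ} {k : ℕ} {E : ℤ → Dtorus n}
    (h : ∀ l, i ≤ l → l ≤ i + k → E l = Ev n l) : rootVec E i k = EEaux n i k := by
  induction k with
  | zero => exact h i le_rfl (by simp)
  | succ k ih =>
    push_cast at h
    rw [rootVec, EEaux, ih fun l hl hl' => h l hl (by omega), h _ (by omega) (by omega), qbr]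

theorem fVec_succ {B : Type*} [Ring B] [Algebra Kq B] (F : ℤ → B) (i : ℤ) (k : ℕ) :
    fVec F i (k + 1) = (qq - qq⁻¹)⁻¹ •
      (F (i + k + 1) * fVec F i k - qq⁻¹ • (fVec F i k * F (i + k + 1))) := by
  have hq := qq_ne_zero
  rw [fVec, fVec, rootVec, qbr, smul_comm, pow_succ]
  congr 1
  simp only [mul_smul_comm, smul_mul_assoc, smul_sub, smul_smul]
  rw [show (-qq⁻¹) ^ k * -qq⁻¹ * qq = -(-qq⁻¹) ^ k by field_simp,
    show (-qq⁻¹) ^ k * -qq⁻¹ = -(qq⁻¹ * (-qq⁻¹) ^ k) by ring, neg_smul, neg_smul]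
  abel

theorem FFaux_eq (n : ℕ) {i : ℤ} {k : ℕ} {F : ℤ → Dtorus n}
    (h : ∀ l, i ≤ l → l ≤ i + k → F l = Fv n l) : fVec F i k = FFaux n i k := by
  induction k with
  | zero => simpa [fVec, rootVec, FFaux] using h i le_rfl (by simp)
  | succ k ih =>
    push_cast at h
    rw [fVec_succ, FFaux, ih fun l hl hl' => h l hl (by omega), h _ (by omega) (by omega)]

theorem list_prod_flatMap {α M : Type*} [Monoid M] (L : List α) (f : α → List M) :
    (L.flatMap f).prod = (L.map fun a => (f a).prod).prod := by
  induction L with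
  | nil => rfl
  | cons a L ih => simp [ih]

theorem quasiRList_prod {n : ℕ} {E F : ℤ → Dtorus n}
    (hE : ∀ l : ℤ, 1 ≤ l → l ≤ n → E l = Ev n l) (hF : ∀ l : ℤ, 1 ≤ l → l ≤ n → F l = Fv n l) :
    (quasiRList n).prod = quasiR n E F n := by
  rw [quasiRList, list_prod_flatMap, quasiR]
  congr 1
  refine List.map_congr_left fun i0 hi0 => ?_
  rw [rRow]
  congr 1
  refine List.map_congr_left fun k hk => ?_
  rw [List.mem_range] at hi0 hk
  rw [rEntry, EEaux_eq n fun l hl hl' => hE l (by omega) (by omega),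
    FFaux_eq n fun l hl hl' => hF l (by omega) (by omega), EE, FF]
  simp

theorem prod_psiH_ww {n : ℕ} {j : ℤ} (hj : 1 ≤ j) (hjn : j ≤ n) {N : ℕ} (hN : (N : ℤ) = 2 * j)
    {y : Dtorus n} :
    ((List.range N).map fun i0 : ℕ => psiH 1 (ww n j (-j + i0) ⊗ₜ[Kq] y)).prod =
      psiH 1 (Ev n j ⊗ₜ[Kq] y) := by
  rw [psiH_sum_range one_pos (fun i0 : ℕ => ww n j (-j + i0) ⊗ₜ[Kq] y), ← TensorProduct.sum_tmul,
    Ev]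
  · congr 2
    refine Finset.sum_bij' (fun a _ => -j + (a : ℤ)) (fun r _ => (r + j).toNat) ?_ ?_ ?_ ?_ ?_
    all_goals
      intro a ha
      simp only [Finset.mem_range, Finset.mem_Icc] at ha ⊢
    all_goals omega
  · intro a b hab hb
    exact (((letterRelations_ww n).self j _ _ hj hjn (by omega) (by omega) (by omega)).tmul
      (QComm.refl y)).congr_exp (add_zero _)

theorem rFactList1_prod (n : ℕ) :
    (rFactList1 n).prod =
      ((negWord n).map fun p => psiH 1 (Ev n (th n p.1) ⊗ₜ[Kq] mm n p.1 p.2)).prod := by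
  simp only [rFactList1, negWord, bind_pure_natCast, List.map_map, Function.comp_def,
    list_prod_flatMap, List.map_flatMap]
  congr 1
  refine List.map_congr_left fun k hk => ?_
  congr 1
  refine List.map_congr_left fun j hj => ?_
  rw [List.mem_range] at hk hj
  rw [prod_psiH_ww (by omega) (by omega) (by push_cast; ring)]
  congr 3
  unfold th
  ring

theorem rFactList2_prod (n : ℕ) :
    (rFactList2 n).prod =
      ((posWord n).map fun p => psiH 1 (Ev n (th n p.1) ⊗ₜ[Kq] mm n p.1 p.2)).prod := by
  simp only [rFactList2, posWord, bind_pure_natCast, List.map_map, Function.comp_def,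
    list_prod_flatMap, List.map_flatMap]
  congr 1
  refine List.map_congr_left fun k hk => ?_
  congr 1
  refine List.map_congr_left fun j hj => ?_
  rw [List.mem_range] at hk hj
  rw [prod_psiH_ww]
  all_goals
    unfold th
    omega

/-- The refined factorization of the quasi `R`-matrix of `U_q(sl_{n+1})`
into `4·C(n+2,3)` quantum dilogarithms of cluster monomials, as an identity in
`(𝒟ₙ ⊗ 𝒟ₙ)⟦t⟧`. -/
theorem statement13 (n : ℕ) (hn : 1 ≤ n) :
    (quasiRList n).prod = (rFactList1 n ++ rFactList2 n).prod := by
  have hW := (letterRelations_ww n).pairwise_letterWord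
  have hE := (serreFamily_wordSum hW).reflect (n + 1)
  have hE' : ∀ l : ℤ, 1 ≤ l → l ≤ n → wordSum (letterWord n (ww n)) (n + 1 - l) = Ev n l := by
    intro l hl hln
    rw [wordSum_letterWord _ (by omega) (by omega), show th n (n + 1 - l) = l by unfold th; ring,
      Ev]
  have hF : ∀ l : ℤ, 1 ≤ l → l ≤ n → wordSum (letterWord n (mm n)) l = Fv n l :=
    fun l hl hln => wordSum_letterWord _ hl hln
  have hth : ∀ p ∈ indexWord n, 1 ≤ th n p.1 ∧ th n p.1 ≤ n := by
    intro p hp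
    rw [mem_indexWord] at hp
    unfold th
    omega
  rw [quasiRList_prod hE' hF, quasiR_wordSum hE (letterRelations_mm n).pairwise_letterWord,
    List.prod_append, rFactList1_prod, rFactList2_prod, ← List.prod_append, ← List.map_append,
    ← indexWord, show letterWord n (mm n) = (indexWord n).map _ from rfl, List.map_map]
  · congr 1
    refine List.map_congr_left fun p hp => ?_
    rw [Function.comp_apply, hE' _ (hth p hp).1 (hth p hp).2]
  · intro p hp
    obtain ⟨p', hp', rfl⟩ := List.mem_map.mp hp
    exact hth p' hp'

end
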